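/- Under the stability setup with hypotheses (H1), (H2), (H3), assume moreover that the comparison principle holds for the limit equation, i.e. every metric viscosity subsolution of H_∞(x, u, |∇_{d_∞} u|) = 0 on (X_∞, d_∞) that is bounded above is ≤ every metric viscosity supersolution that is bounded below. Suppose for each n ∈ ℕ the function u^n : X_n → ℝ is a metric viscosity solution (both sub- and supersolution) of H_n(x, u^n, |∇_{d_n} u^n|) = 0, the family (u^n) is uniformly bounded, and u^∞ : X_∞ → ℝ is a bounded metric viscosity solution of H_∞(x, u^∞, |∇_{d_∞} u^∞|) = 0. Then the upper semilimit ū and the lower semilimit u̲ of (u^n) coincide with u^∞ on X_∞; in particular u^n converges to u^∞ uniformly: for every ε > 0 there exist N ∈ ℕ and δ > 0 such that for all n ≥ N, x ∈ X_n and y ∈ X_∞ with 𝖽(x, y) < δ one has |u^n(x) − u^∞(y)| < ε. -/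

import Mathlib

open Filter Metric Set Topology

/-- Local slope of `u` at `x`, relative to a set `s` and a distance-like function `ρ`. -/
noncomputable def slopeWrt {α : Type*} [TopologicalSpace α] (s : Set α) (ρ : α → α → ℝ)
    (u : α → ℝ) (x : α) : ℝ :=
  Filter.limsup (fun y => |u y - u x| / ρ x y) (nhdsWithin x (s \ {x}))

/-- Upper local slope. -/
noncomputable def upperSlopeWrt {α : Type*} [TopologicalSpace α] (s : Set α) (ρ : α → α → ℝ)
    (u : α → ℝ) (x : α) : ℝ :=
  Filter.limsup (fun y => max (u y - u x) 0 / ρ x y) (nhdsWithin x (s \ {x}))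

/-- Lower local slope. -/
noncomputable def lowerSlopeWrt {α : Type*} [TopologicalSpace α] (s : Set α) (ρ : α → α → ℝ)
    (u : α → ℝ) (x : α) : ℝ :=
  Filter.limsup (fun y => max (u x - u y) 0 / ρ x y) (nhdsWithin x (s \ {x}))

/-- `u` is locally Lipschitz on `s` with respect to `ρ`. -/
def LocLipWrt {α : Type*} [TopologicalSpace α] (s : Set α) (ρ : α → α → ℝ)
    (u : α → ℝ) : Prop :=
  ∀ x ∈ s, ∃ K : ℝ, ∃ t ∈ nhdsWithin x s, ∀ y ∈ t ∩ s, ∀ z ∈ t ∩ s, |u y - u z| ≤ K * ρ y z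

/-- `u` is of class `C^{1,-}`: locally Lipschitz, with continuous local slope which
coincides with the lower local slope. -/
def IsC1MinusWrt {α : Type*} [TopologicalSpace α] (s : Set α) (ρ : α → α → ℝ)
    (u : α → ℝ) : Prop :=
  LocLipWrt s ρ u ∧ ContinuousOn (slopeWrt s ρ u) s ∧
    ∀ x ∈ s, lowerSlopeWrt s ρ u x = slopeWrt s ρ u x

/-- `u` is of class `C^{1,+}`: locally Lipschitz, with continuous local slope which
coincides with the upper local slope. -/
def IsC1PlusWrt {α : Type*} [TopologicalSpace α] (s : Set α) (ρ : α → α → ℝ)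
    (u : α → ℝ) : Prop :=
  LocLipWrt s ρ u ∧ ContinuousOn (slopeWrt s ρ u) s ∧
    ∀ x ∈ s, upperSlopeWrt s ρ u x = slopeWrt s ρ u x

/-- Upper semicontinuous envelope of `u` relative to `s`. -/
noncomputable def uscWrt {α : Type*} [TopologicalSpace α] (s : Set α) (u : α → ℝ) (x : α) : ℝ :=
  Filter.limsup u (nhdsWithin x s)

/-- Lower semicontinuous envelope of `u` relative to `s`. -/
noncomputable def lscWrt {α : Type*} [TopologicalSpace α] (s : Set α) (u : α → ℝ) (x : α) : ℝ :=
  Filter.liminf u (nhdsWithin x s)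

/-- `H_a(x,r,p) = inf { H x r q | q ≥ 0, |q - p| ≤ a }`. -/
noncomputable def Hlow {α : Type*} (H : α → ℝ → ℝ → ℝ) (a : ℝ) (x : α) (r p : ℝ) : ℝ :=
  sInf (H x r '' {q | 0 ≤ q ∧ |q - p| ≤ a})

/-- `H^a(x,r,p) = sup { H x r q | q ≥ 0, |q - p| ≤ a }`. -/
noncomputable def Hupp {α : Type*} (H : α → ℝ → ℝ → ℝ) (a : ℝ) (x : α) (r p : ℝ) : ℝ :=
  sSup (H x r '' {q | 0 ≤ q ∧ |q - p| ≤ a})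

/-- Metric viscosity subsolution of `H(x, u, |∇u|) = 0` on the space `(s, ρ)`. -/
def IsMVSubsolutionWrt {α : Type*} [TopologicalSpace α] (s : Set α) (ρ : α → α → ℝ)
    (H : α → ℝ → ℝ → ℝ) (u : α → ℝ) : Prop :=
  ∀ ψ₁ ψ₂ : α → ℝ, IsC1MinusWrt s ρ ψ₁ → LocLipWrt s ρ ψ₂ →
    ∀ x ∈ s, IsLocalMaxOn (fun y => uscWrt s u y - (ψ₁ y + ψ₂ y)) s x →
      Hlow H (uscWrt s (slopeWrt s ρ ψ₂) x) x (uscWrt s u x) (slopeWrt s ρ ψ₁ x) ≤ 0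

/-- Metric viscosity supersolution of `H(x, u, |∇u|) = 0` on the space `(s, ρ)`. -/
def IsMVSupersolutionWrt {α : Type*} [TopologicalSpace α] (s : Set α) (ρ : α → α → ℝ)
    (H : α → ℝ → ℝ → ℝ) (u : α → ℝ) : Prop :=
  ∀ ψ₁ ψ₂ : α → ℝ, IsC1PlusWrt s ρ ψ₁ → LocLipWrt s ρ ψ₂ →
    ∀ x ∈ s, IsLocalMinOn (fun y => lscWrt s u y - (ψ₁ y + ψ₂ y)) s x →
      0 ≤ Hupp H (uscWrt s (slopeWrt s ρ ψ₂) x) x (lscWrt s u x) (slopeWrt s ρ ψ₁ x)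

/-- `(s, ρ)` is a geodesic space: any two points are joined by an isometric
embedding of the interval `[0, ρ x y]`. -/
def IsGeodesicWrt {α : Type*} (s : Set α) (ρ : α → α → ℝ) : Prop :=
  ∀ x ∈ s, ∀ y ∈ s, ∃ γ : ℝ → α, γ 0 = x ∧ γ (ρ x y) = y ∧
    (∀ t ∈ Icc (0:ℝ) (ρ x y), γ t ∈ s) ∧
    ∀ t₁ ∈ Icc (0:ℝ) (ρ x y), ∀ t₂ ∈ Icc (0:ℝ) (ρ x y), ρ (γ t₁) (γ t₂) = |t₁ - t₂|

/-- Strict local maximum of `f` on `s` at `x`. -/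
def IsStrictLocalMaxOn' {α : Type*} [TopologicalSpace α] (f : α → ℝ) (s : Set α) (x : α) : Prop :=
  ∀ᶠ y in nhdsWithin x (s \ {x}), f y < f x

/-- Strict local minimum of `f` on `s` at `x`. -/
def IsStrictLocalMinOn' {α : Type*} [TopologicalSpace α] (f : α → ℝ) (s : Set α) (x : α) : Prop :=
  ∀ᶠ y in nhdsWithin x (s \ {x}), f x < f y

/-- `u` is locally bounded on `s`. -/
def LocBddWrt {α : Type*} [TopologicalSpace α] (s : Set α) (u : α → ℝ) : Prop :=
  ∀ x ∈ s, ∃ C : ℝ, ∀ᶠ y in nhdsWithin x s, |u y| ≤ C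

/-- `ρ` is a metric on the subset `S` of the ambient metric space `Y`, bounded below by the
ambient distance and inducing the subspace topology on `S`. -/
structure IsMetricOn {Y : Type*} [MetricSpace Y] (S : Set Y) (ρ : Y → Y → ℝ) : Prop where
  refl : ∀ x ∈ S, ρ x x = 0
  symm : ∀ x ∈ S, ∀ y ∈ S, ρ x y = ρ y x
  triangle : ∀ x ∈ S, ∀ y ∈ S, ∀ z ∈ S, ρ x z ≤ ρ x y + ρ y z
  ge_dist : ∀ x ∈ S, ∀ y ∈ S, dist x y ≤ ρ x y
  nhds_basis : ∀ x ∈ S, (nhdsWithin x S).HasBasis (fun ε : ℝ => 0 < ε)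
    (fun ε => {y | y ∈ S ∧ ρ x y < ε})

/-- Spatial local slope of `ψ : (0,∞) × X → ℝ` at `z = (t, x)`. -/
noncomputable def slopeSpWrt {α : Type*} [TopologicalSpace α] (s : Set α) (ρ : α → α → ℝ)
    (ψ : ℝ × α → ℝ) (z : ℝ × α) : ℝ :=
  Filter.limsup (fun y => |ψ (z.1, y) - ψ z| / ρ z.2 y) (nhdsWithin z.2 (s \ {z.2}))

/-- Spatial upper local slope. -/
noncomputable def upperSlopeSpWrt {α : Type*} [TopologicalSpace α] (s : Set α) (ρ : α → α → ℝ)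
    (ψ : ℝ × α → ℝ) (z : ℝ × α) : ℝ :=
  Filter.limsup (fun y => max (ψ (z.1, y) - ψ z) 0 / ρ z.2 y) (nhdsWithin z.2 (s \ {z.2}))

/-- Spatial lower local slope. -/
noncomputable def lowerSlopeSpWrt {α : Type*} [TopologicalSpace α] (s : Set α) (ρ : α → α → ℝ)
    (ψ : ℝ × α → ℝ) (z : ℝ × α) : ℝ :=
  Filter.limsup (fun y => max (ψ z - ψ (z.1, y)) 0 / ρ z.2 y) (nhdsWithin z.2 (s \ {z.2}))

/-- Product (max) metric on `ℝ × α` built from `ρ`. -/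
def prodMet {α : Type*} (ρ : α → α → ℝ) : ℝ × α → ℝ × α → ℝ :=
  fun z w => max |z.1 - w.1| (ρ z.2 w.2)

/-- Metric viscosity subsolution of `∂ₜ u + H(t, x, u, |∇u|) = 0` on `(0,∞) × (s, ρ)`. -/
def IsMVSubsolutionTWrt {α : Type*} [TopologicalSpace α] (s : Set α) (ρ : α → α → ℝ)
    (H : ℝ → α → ℝ → ℝ → ℝ) (u : ℝ × α → ℝ) : Prop :=
  ∀ ψ₁ ψ₂ dψ₁ dψ₂ : ℝ × α → ℝ,
    LocLipWrt (Ioi (0:ℝ) ×ˢ s) (prodMet ρ) ψ₁ →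
    LocLipWrt (Ioi (0:ℝ) ×ˢ s) (prodMet ρ) ψ₂ →
    (∀ z ∈ Ioi (0:ℝ) ×ˢ s, HasDerivAt (fun τ => ψ₁ (τ, z.2)) (dψ₁ z) z.1) →
    ContinuousOn dψ₁ (Ioi (0:ℝ) ×ˢ s) →
    (∀ z ∈ Ioi (0:ℝ) ×ˢ s, HasDerivAt (fun τ => ψ₂ (τ, z.2)) (dψ₂ z) z.1) →
    ContinuousOn dψ₂ (Ioi (0:ℝ) ×ˢ s) →
    ContinuousOn (slopeSpWrt s ρ ψ₁) (Ioi (0:ℝ) ×ˢ s) →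
    (∀ z ∈ Ioi (0:ℝ) ×ˢ s, lowerSlopeSpWrt s ρ ψ₁ z = slopeSpWrt s ρ ψ₁ z) →
    ∀ z ∈ Ioi (0:ℝ) ×ˢ s,
      IsLocalMaxOn (fun w => uscWrt (Ioi (0:ℝ) ×ˢ s) u w - (ψ₁ w + ψ₂ w))
        (Ioi (0:ℝ) ×ˢ s) z →
      dψ₁ z + dψ₂ z +
        Hlow (fun w : ℝ × α => H w.1 w.2)
          (uscWrt (Ioi (0:ℝ) ×ˢ s) (slopeSpWrt s ρ ψ₂) z) z
          (uscWrt (Ioi (0:ℝ) ×ˢ s) u z) (slopeSpWrt s ρ ψ₁ z) ≤ 0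

/-- Metric viscosity supersolution of `∂ₜ u + H(t, x, u, |∇u|) = 0` on `(0,∞) × (s, ρ)`. -/
def IsMVSupersolutionTWrt {α : Type*} [TopologicalSpace α] (s : Set α) (ρ : α → α → ℝ)
    (H : ℝ → α → ℝ → ℝ → ℝ) (u : ℝ × α → ℝ) : Prop :=
  ∀ ψ₁ ψ₂ dψ₁ dψ₂ : ℝ × α → ℝ,
    LocLipWrt (Ioi (0:ℝ) ×ˢ s) (prodMet ρ) ψ₁ →
    LocLipWrt (Ioi (0:ℝ) ×ˢ s) (prodMet ρ) ψ₂ →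
    (∀ z ∈ Ioi (0:ℝ) ×ˢ s, HasDerivAt (fun τ => ψ₁ (τ, z.2)) (dψ₁ z) z.1) →
    ContinuousOn dψ₁ (Ioi (0:ℝ) ×ˢ s) →
    (∀ z ∈ Ioi (0:ℝ) ×ˢ s, HasDerivAt (fun τ => ψ₂ (τ, z.2)) (dψ₂ z) z.1) →
    ContinuousOn dψ₂ (Ioi (0:ℝ) ×ˢ s) →
    ContinuousOn (slopeSpWrt s ρ ψ₁) (Ioi (0:ℝ) ×ˢ s) →
    (∀ z ∈ Ioi (0:ℝ) ×ˢ s, upperSlopeSpWrt s ρ ψ₁ z = slopeSpWrt s ρ ψ₁ z) →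
    ∀ z ∈ Ioi (0:ℝ) ×ˢ s,
      IsLocalMinOn (fun w => lscWrt (Ioi (0:ℝ) ×ˢ s) u w - (ψ₁ w + ψ₂ w))
        (Ioi (0:ℝ) ×ˢ s) z →
      0 ≤ dψ₁ z + dψ₂ z +
        Hupp (fun w : ℝ × α => H w.1 w.2)
          (uscWrt (Ioi (0:ℝ) ×ˢ s) (slopeSpWrt s ρ ψ₂) z) z
          (lscWrt (Ioi (0:ℝ) ×ˢ s) u z) (slopeSpWrt s ρ ψ₁ z)

/-! ### Real-valued limsup -/

theorem real_limsup_nonneg {α : Type*} {l : Filter α} {f : α → ℝ} (h0 : ∀ᶠ y in l, 0 ≤ f y) :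
    0 ≤ limsup f l := by
  rw [Filter.limsup_eq]
  rcases l.eq_or_neBot with rfl | hl
  · simp
  · refine Real.sInf_nonneg fun a ha => ?_
    obtain ⟨y, h1, h2⟩ := (h0.and ha).exists
    exact h1.trans h2

theorem real_limsup_le {α : Type*} {l : Filter α} {f : α → ℝ} {c : ℝ} (hc : 0 ≤ c)
    (h0 : ∀ᶠ y in l, 0 ≤ f y) (h : ∀ᶠ y in l, f y ≤ c) : limsup f l ≤ c := by
  rw [Filter.limsup_eq]
  rcases l.eq_or_neBot with rfl | hl
  · simpa using hc
  · refine csInf_le ⟨0, fun a ha => ?_⟩ h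
    obtain ⟨y, h1, h2⟩ := (h0.and ha).exists
    exact h1.trans h2

theorem real_limsup_neg {α : Type*} (l : Filter α) (f : α → ℝ) :
    limsup (fun y => -f y) l = -liminf f l := by
  rw [Filter.limsup_eq, Filter.liminf_eq, ← Real.sInf_neg]
  congr 1
  ext a
  simp [neg_le]

/-! ### Metrics on subsets -/

section MetricOn

variable {Y : Type*} [MetricSpace Y] {S : Set Y} {ρ : Y → Y → ℝ}

theorem IsMetricOn.nonneg (h : IsMetricOn S ρ) {x y : Y} (hx : x ∈ S) (hy : y ∈ S) : 0 ≤ ρ x y :=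
  dist_nonneg.trans (h.ge_dist x hx y hy)

theorem IsMetricOn.eq_of_le_zero (h : IsMetricOn S ρ) {x y : Y} (hx : x ∈ S) (hy : y ∈ S)
    (h0 : ρ x y ≤ 0) : x = y :=
  dist_le_zero.1 ((h.ge_dist x hx y hy).trans h0)

theorem IsMetricOn.pos (h : IsMetricOn S ρ) {x y : Y} (hx : x ∈ S) (hy : y ∈ S) (hne : x ≠ y) :
    0 < ρ x y :=
  lt_of_not_ge fun h0 => hne (h.eq_of_le_zero hx hy h0)

theorem IsMetricOn.tendsto_zero (h : IsMetricOn S ρ) {x : Y} (hx : x ∈ S) :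
    Tendsto (fun y => ρ x y) (𝓝[S] x) (𝓝 0) := by
  rw [Metric.tendsto_nhds]
  intro ε hε
  filter_upwards [(h.nhds_basis x hx).mem_of_mem hε] with y hy
  rw [Real.dist_eq, sub_zero, abs_of_nonneg (h.nonneg hx hy.1)]
  exact hy.2

theorem IsMetricOn.tendsto {ι : Type*} {l : Filter ι} (h : IsMetricOn S ρ) {x y : Y} (hx : x ∈ S)
    (hy : y ∈ S) {f g : ι → Y} (hf : ∀ᶠ i in l, f i ∈ S) (hg : ∀ᶠ i in l, g i ∈ S)
    (hfx : Tendsto f l (𝓝 x)) (hgy : Tendsto g l (𝓝 y)) :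
    Tendsto (fun i => ρ (f i) (g i)) l (𝓝 (ρ x y)) := by
  have h1 := (h.tendsto_zero hx).comp
    (tendsto_nhdsWithin_iff.2 ⟨hfx, hf⟩)
  have h2 := (h.tendsto_zero hy).comp
    (tendsto_nhdsWithin_iff.2 ⟨hgy, hg⟩)
  have h3 := h1.add h2
  rw [add_zero] at h3
  refine tendsto_iff_dist_tendsto_zero.2 (squeeze_zero' (Eventually.of_forall fun _ => dist_nonneg)
    ?_ h3)
  filter_upwards [hf, hg] with i hf hg
  rw [Real.dist_eq, abs_le]
  have t1 := h.triangle x hx _ hf y hy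
  have t2 := h.triangle _ hf _ hg y hy
  have t3 := h.triangle _ hf x hx _ hg
  have t4 := h.triangle x hx y hy _ hg
  have s1 := h.symm _ hf x hx
  have s2 := h.symm _ hg y hy
  simp only [Function.comp]
  constructor <;> linarith

theorem IsMetricOn.abs_sub_le (h : IsMetricOn S ρ) {x y a : Y} (hx : x ∈ S) (hy : y ∈ S)
    (ha : a ∈ S) : |ρ y a - ρ x a| ≤ ρ x y := by
  have t1 := h.triangle x hx y hy a ha
  have t2 := h.triangle y hy x hx a ha
  have s := h.symm x hx y hy
  rw [abs_le]
  constructor <;> linarith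

theorem IsMetricOn.continuousOn (h : IsMetricOn S ρ) {a : Y} (ha : a ∈ S) :
    ContinuousOn (fun y => ρ y a) S := by
  intro x hx
  refine tendsto_iff_dist_tendsto_zero.2 (squeeze_zero' (Eventually.of_forall fun _ => dist_nonneg)
    ?_ (h.tendsto_zero hx))
  filter_upwards [self_mem_nhdsWithin] with y hy
  exact h.abs_sub_le hx hy ha

theorem LocLipWrt.continuousOn (h : IsMetricOn S ρ) {f : Y → ℝ} (hf : LocLipWrt S ρ f) :
    ContinuousOn f S := by
  intro x hx
  obtain ⟨K, t, ht, hK⟩ := hf x hx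
  have h1 := (h.tendsto_zero hx).const_mul K
  rw [mul_zero] at h1
  refine tendsto_iff_dist_tendsto_zero.2 (squeeze_zero' (Eventually.of_forall fun _ => dist_nonneg)
    ?_ h1)
  filter_upwards [self_mem_nhdsWithin, ht] with y hy hyt
  rw [dist_comm]
  exact hK x ⟨mem_of_mem_nhdsWithin hx ht, hx⟩ y ⟨hyt, hy⟩

/-! ### Slopes -/

theorem slope_quotient_nonneg (h : IsMetricOn S ρ) {x : Y} (hx : x ∈ S) {g : Y → ℝ}
    (hg : ∀ y, 0 ≤ g y) : ∀ᶠ y in 𝓝[S \ {x}] x, 0 ≤ g y / ρ x y := by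
  filter_upwards [self_mem_nhdsWithin] with y hy
  exact div_nonneg (hg y) (h.nonneg hx hy.1)

theorem slope_quotient_le (h : IsMetricOn S ρ) {x : Y} (hx : x ∈ S) {g : Y → ℝ} {c : ℝ}
    (hc : ∀ᶠ y in 𝓝[S \ {x}] x, g y ≤ c * ρ x y) : ∀ᶠ y in 𝓝[S \ {x}] x, g y / ρ x y ≤ c := by
  filter_upwards [self_mem_nhdsWithin, hc] with y hy hgy
  rwa [div_le_iff₀ (h.pos hx hy.1 (Ne.symm hy.2))]

theorem slopeWrt_nonneg (h : IsMetricOn S ρ) {x : Y} (hx : x ∈ S) (f : Y → ℝ) :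
    0 ≤ slopeWrt S ρ f x :=
  real_limsup_nonneg (slope_quotient_nonneg h hx fun _ => abs_nonneg _)

theorem slopeWrt_le (h : IsMetricOn S ρ) {x : Y} (hx : x ∈ S) {f : Y → ℝ} {c : ℝ} (hc0 : 0 ≤ c)
    (hc : ∀ᶠ y in 𝓝[S \ {x}] x, |f y - f x| ≤ c * ρ x y) : slopeWrt S ρ f x ≤ c :=
  real_limsup_le hc0 (slope_quotient_nonneg h hx fun _ => abs_nonneg _) (slope_quotient_le h hx hc)

theorem lowerSlopeWrt_le (h : IsMetricOn S ρ) {x : Y} (hx : x ∈ S) {f : Y → ℝ} {c : ℝ}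
    (hc0 : 0 ≤ c) (hc : ∀ᶠ y in 𝓝[S \ {x}] x, f x - f y ≤ c * ρ x y) :
    lowerSlopeWrt S ρ f x ≤ c := by
  refine real_limsup_le hc0 (slope_quotient_nonneg h hx fun _ => le_max_right _ _)
    (slope_quotient_le h hx ?_)
  filter_upwards [self_mem_nhdsWithin, hc] with y hy hfy
  exact max_le hfy (mul_nonneg hc0 (h.nonneg hx hy.1))

theorem LocLipWrt.exists_eventually_abs_le (h : IsMetricOn S ρ) {f : Y → ℝ}
    (hf : LocLipWrt S ρ f) {x : Y} (hx : x ∈ S) :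
    ∃ K, 0 ≤ K ∧ ∀ᶠ z in 𝓝[S] x, ∀ᶠ y in 𝓝[S \ {z}] z, |f y - f z| ≤ K * ρ z y := by
  obtain ⟨K, t, ht, hK⟩ := hf x hx
  refine ⟨max K 0, le_max_right _ _, ?_⟩
  filter_upwards [self_mem_nhdsWithin, eventually_eventually_nhdsWithin.2 ht,
    (ht : ∀ᶠ y in 𝓝[S] x, y ∈ t)] with z hz hzt hzt'
  filter_upwards [self_mem_nhdsWithin, nhdsWithin_mono z sdiff_subset hzt] with y hy hyt
  rw [abs_sub_comm]
  exact (hK z ⟨hzt', hz⟩ y ⟨hyt, hy.1⟩).trans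
    (mul_le_mul_of_nonneg_right (le_max_left _ _) (h.nonneg hz hy.1))

theorem LocLipWrt.exists_eventually_slopeWrt_le (h : IsMetricOn S ρ) {f : Y → ℝ}
    (hf : LocLipWrt S ρ f) {x : Y} (hx : x ∈ S) :
    ∃ K, ∀ᶠ z in 𝓝[S] x, slopeWrt S ρ f z ≤ K := by
  obtain ⟨K, hK0, hK⟩ := hf.exists_eventually_abs_le h hx
  refine ⟨K, ?_⟩
  filter_upwards [self_mem_nhdsWithin, hK] with z hz hzK
  exact slopeWrt_le h hz hK0 hzK

theorem LocLipWrt.eventually_abs_le (h : IsMetricOn S ρ) {f : Y → ℝ}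
    (hf : LocLipWrt S ρ f) {x : Y} (hx : x ∈ S) {c : ℝ} (hc : slopeWrt S ρ f x < c) :
    ∀ᶠ y in 𝓝[S \ {x}] x, |f y - f x| ≤ c * ρ x y := by
  obtain ⟨K, -, hK⟩ := hf.exists_eventually_abs_le h hx
  have hK' := slope_quotient_le h hx (hK.self_of_nhdsWithin hx)
  filter_upwards [self_mem_nhdsWithin, eventually_lt_of_limsup_lt hc
    (isBoundedUnder_of_eventually_le hK')] with y hy hfy
  rw [div_lt_iff₀ (h.pos hx hy.1 (Ne.symm hy.2))] at hfy
  exact hfy.le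

theorem LocLipWrt.eventually_sub_le (h : IsMetricOn S ρ) {f : Y → ℝ}
    (hf : LocLipWrt S ρ f) {x : Y} (hx : x ∈ S) {c : ℝ} (hc : lowerSlopeWrt S ρ f x < c) :
    ∀ᶠ y in 𝓝[S \ {x}] x, f x - f y ≤ c * ρ x y := by
  obtain ⟨K, hK0, hK⟩ := hf.exists_eventually_abs_le h hx
  have hK' : ∀ᶠ y in 𝓝[S \ {x}] x, max (f x - f y) 0 / ρ x y ≤ K := by
    refine slope_quotient_le h hx ?_
    filter_upwards [self_mem_nhdsWithin, hK.self_of_nhdsWithin hx] with y hy hfy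
    exact max_le (by linarith [neg_abs_le (f y - f x)]) (mul_nonneg hK0 (h.nonneg hx hy.1))
  filter_upwards [self_mem_nhdsWithin, eventually_lt_of_limsup_lt hc
    (isBoundedUnder_of_eventually_le hK')] with y hy hfy
  rw [div_lt_iff₀ (h.pos hx hy.1 (Ne.symm hy.2))] at hfy
  exact (le_max_left _ _).trans hfy.le

/-! ### Geodesics and squared distance functions -/

theorem IsGeodesicWrt.exists_approach (hg : IsGeodesicWrt S ρ) (h : IsMetricOn S ρ) {x a : Y}
    (hx : x ∈ S) (ha : a ∈ S) (hne : x ≠ a) :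
    ∃ γ : ℝ → Y, Tendsto γ (𝓝[>] 0) (𝓝[S \ {x}] x) ∧
      ∀ᶠ t in 𝓝[>] (0 : ℝ), ρ x (γ t) = t ∧ ρ (γ t) a = ρ x a - t := by
  obtain ⟨γ, h0, h1, hS, hγ⟩ := hg x hx a ha
  have hpos := h.pos hx ha hne
  have hev : ∀ᶠ t in 𝓝[>] (0 : ℝ), t ∈ Ioo 0 (ρ x a) := Ioo_mem_nhdsGT hpos
  have hdist : ∀ t ∈ Ioo 0 (ρ x a), ρ x (γ t) = t := fun t ht => by
    have := hγ 0 ⟨le_rfl, hpos.le⟩ t ⟨ht.1.le, ht.2.le⟩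
    rwa [h0, zero_sub, abs_neg, abs_of_pos ht.1] at this
  refine ⟨γ, tendsto_nhdsWithin_iff.2 ⟨?_, ?_⟩, ?_⟩
  · refine tendsto_iff_dist_tendsto_zero.2 (squeeze_zero' (Eventually.of_forall fun _ =>
      dist_nonneg) ?_ (tendsto_nhdsWithin_of_tendsto_nhds tendsto_id))
    filter_upwards [hev] with t ht
    rw [dist_comm, id]
    exact (h.ge_dist x hx _ (hS t ⟨ht.1.le, ht.2.le⟩)).trans (hdist t ht).le
  · filter_upwards [hev] with t ht
    refine ⟨hS t ⟨ht.1.le, ht.2.le⟩, fun hxt => ?_⟩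
    have := hdist t ht
    rw [mem_singleton_iff.1 hxt, h.refl x hx] at this
    exact ht.1.ne this
  · filter_upwards [hev] with t ht
    refine ⟨hdist t ht, ?_⟩
    have := hγ t ⟨ht.1.le, ht.2.le⟩ (ρ x a) ⟨hpos.le, le_rfl⟩
    rwa [h1, abs_sub_comm, abs_of_pos (sub_pos.2 ht.2)] at this

theorem IsMetricOn.abs_sq_sub_le (h : IsMetricOn S ρ) {κ : ℝ} (hκ : 0 ≤ κ) {x y a : Y}
    (hx : x ∈ S) (hy : y ∈ S) (ha : a ∈ S) :
    |κ / 2 * ρ y a ^ 2 - κ / 2 * ρ x a ^ 2| ≤ κ / 2 * (ρ y a + ρ x a) * ρ x y := by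
  have h1 := h.nonneg hx ha
  have h2 := h.nonneg hy ha
  rw [show κ / 2 * ρ y a ^ 2 - κ / 2 * ρ x a ^ 2 = κ / 2 * (ρ y a + ρ x a) * (ρ y a - ρ x a) by
    ring, abs_mul, abs_of_nonneg (by positivity)]
  exact mul_le_mul_of_nonneg_left (h.abs_sub_le hx hy ha) (by positivity)

theorem locLipWrt_sq (h : IsMetricOn S ρ) {κ : ℝ} (hκ : 0 ≤ κ) {a : Y} (ha : a ∈ S) :
    LocLipWrt S ρ (fun y => κ / 2 * ρ y a ^ 2) := by
  intro x hx
  refine ⟨κ / 2 * (2 * (ρ x a + 1)), {y | ρ y a < ρ x a + 1},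
    (h.continuousOn ha x hx).eventually_lt_const (lt_add_one _), ?_⟩
  rintro y ⟨hy, hyS⟩ z ⟨hz, hzS⟩
  rw [mem_ofPred_eq] at hy hz
  rw [abs_sub_comm]
  refine (h.abs_sq_sub_le hκ hyS hzS ha).trans (mul_le_mul_of_nonneg_right
    (mul_le_mul_of_nonneg_left (by linarith) (by positivity)) (h.nonneg hyS hzS))

theorem slopeWrt_sq_le (h : IsMetricOn S ρ) {κ : ℝ} (hκ : 0 ≤ κ) {x a : Y} (hx : x ∈ S)
    (ha : a ∈ S) : slopeWrt S ρ (fun y => κ / 2 * ρ y a ^ 2) x ≤ κ * ρ x a := by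
  refine le_of_forall_pos_le_add fun ε hε => ?_
  have h0 := h.nonneg hx ha
  refine slopeWrt_le h hx (by positivity) ?_
  have hlim : Tendsto (fun y => κ / 2 * (ρ y a + ρ x a)) (𝓝[S \ {x}] x)
      (𝓝 (κ / 2 * (ρ x a + ρ x a))) :=
    (((h.continuousOn ha x hx).mono_left (nhdsWithin_mono x sdiff_subset)).add_const _).const_mul _
  filter_upwards [self_mem_nhdsWithin, hlim.eventually_lt_const
    (show κ / 2 * (ρ x a + ρ x a) < κ * ρ x a + ε by linarith)] with y hy hlt
  exact (h.abs_sq_sub_le hκ hx hy.1 ha).trans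
    (mul_le_mul_of_nonneg_right hlt.le (h.nonneg hx hy.1))

theorem le_lowerSlopeWrt_sq (hg : IsGeodesicWrt S ρ) (h : IsMetricOn S ρ) {κ : ℝ} (hκ : 0 ≤ κ)
    {x a : Y} (hx : x ∈ S) (ha : a ∈ S) :
    κ * ρ x a ≤ lowerSlopeWrt S ρ (fun y => κ / 2 * ρ y a ^ 2) x := by
  by_cases hxa : x = a
  · rw [hxa, h.refl a ha, mul_zero]
    exact real_limsup_nonneg (slope_quotient_nonneg h ha fun _ => le_max_right _ _)
  refine le_of_forall_gt_imp_ge_of_dense fun c hc => ?_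
  obtain ⟨γ, hγ, hγd⟩ := hg.exists_approach h hx ha hxa
  have hev := hγ.eventually ((locLipWrt_sq h hκ ha).eventually_sub_le h hx hc)
  have hlim : Tendsto (fun t : ℝ => κ * ρ x a - κ / 2 * t) (𝓝[>] 0)
      (𝓝 (κ * ρ x a - κ / 2 * 0)) :=
    tendsto_nhdsWithin_of_tendsto_nhds (tendsto_const_nhds.sub (tendsto_id.const_mul _))
  rw [mul_zero, sub_zero] at hlim
  refine le_of_tendsto hlim ?_
  filter_upwards [hev, hγd, self_mem_nhdsWithin] with t ht htd (ht0 : 0 < t)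
  rw [htd.1, htd.2] at ht
  refine le_of_mul_le_mul_right ?_ ht0
  linarith

theorem lowerSlopeWrt_le_slopeWrt (h : IsMetricOn S ρ) {f : Y → ℝ} (hf : LocLipWrt S ρ f) {x : Y}
    (hx : x ∈ S) : lowerSlopeWrt S ρ f x ≤ slopeWrt S ρ f x := by
  refine le_of_forall_gt_imp_ge_of_dense fun c hc => lowerSlopeWrt_le h hx
    ((slopeWrt_nonneg h hx f).trans hc.le) ?_
  filter_upwards [hf.eventually_abs_le h hx hc] with y hy
  linarith [neg_abs_le (f y - f x)]

theorem slopeWrt_sq (hg : IsGeodesicWrt S ρ) (h : IsMetricOn S ρ) {κ : ℝ} (hκ : 0 ≤ κ)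
    {x a : Y} (hx : x ∈ S) (ha : a ∈ S) :
    slopeWrt S ρ (fun y => κ / 2 * ρ y a ^ 2) x = κ * ρ x a :=
  (slopeWrt_sq_le h hκ hx ha).antisymm ((le_lowerSlopeWrt_sq hg h hκ hx ha).trans
    (lowerSlopeWrt_le_slopeWrt h (locLipWrt_sq h hκ ha) hx))

theorem isC1MinusWrt_sq (hg : IsGeodesicWrt S ρ) (h : IsMetricOn S ρ) {κ : ℝ} (hκ : 0 ≤ κ)
    {a : Y} (ha : a ∈ S) : IsC1MinusWrt S ρ (fun y => κ / 2 * ρ y a ^ 2) := by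
  have hL := locLipWrt_sq h hκ ha
  refine ⟨hL, ?_, fun x hx => (lowerSlopeWrt_le_slopeWrt h hL hx).antisymm
    ((slopeWrt_sq_le h hκ hx ha).trans (le_lowerSlopeWrt_sq hg h hκ hx ha))⟩
  exact ((h.continuousOn ha).const_smul κ).congr fun x hx => slopeWrt_sq hg h hκ hx ha

end MetricOn

/-! ### Semicontinuous envelopes -/

section Envelope

variable {α : Type*} [TopologicalSpace α] {S : Set α} {u : α → ℝ} {C : ℝ}

theorem isBoundedUnder_le_nhdsWithin (hC : ∀ x ∈ S, |u x| ≤ C) (x : α) :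
    IsBoundedUnder (· ≤ ·) (𝓝[S] x) u :=
  isBoundedUnder_of_eventually_le (eventually_mem_nhdsWithin.mono fun y hy =>
    (le_abs_self _).trans (hC y hy))

theorem isCoboundedUnder_le_nhdsWithin (hC : ∀ x ∈ S, |u x| ≤ C) {x : α} (hx : x ∈ S) :
    IsCoboundedUnder (· ≤ ·) (𝓝[S] x) u := by
  have := nhdsWithin_neBot_of_mem hx
  exact IsBoundedUnder.isCoboundedUnder_le (isBoundedUnder_of_eventually_ge (a := -C)
    (eventually_mem_nhdsWithin.mono fun y hy => (abs_le.1 (hC y hy)).1))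

theorem le_uscWrt (hC : ∀ x ∈ S, |u x| ≤ C) {x : α} (hx : x ∈ S) : u x ≤ uscWrt S u x :=
  le_of_forall_gt_imp_ge_of_dense fun _ hc =>
    (eventually_lt_of_limsup_lt hc (isBoundedUnder_le_nhdsWithin hC x)).self_of_nhdsWithin hx |>.le

theorem uscWrt_le (hC : ∀ x ∈ S, |u x| ≤ C) {x : α} (hx : x ∈ S) {c : ℝ}
    (hc : ∀ᶠ y in 𝓝[S] x, u y ≤ c) : uscWrt S u x ≤ c :=
  limsup_le_of_le (isCoboundedUnder_le_nhdsWithin hC hx) hc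

theorem upperSemicontinuousOn_uscWrt (hC : ∀ x ∈ S, |u x| ≤ C) :
    UpperSemicontinuousOn (uscWrt S u) S := by
  intro x hx c hc
  obtain ⟨c', hc1, hc2⟩ := exists_between hc
  have h1 := eventually_lt_of_limsup_lt hc1 (isBoundedUnder_le_nhdsWithin hC x)
  filter_upwards [self_mem_nhdsWithin, eventually_eventually_nhdsWithin.2 h1] with y hy hyc
  exact (uscWrt_le hC hy (hyc.mono fun _ hz => hz.le)).trans_lt hc2

theorem UpperSemicontinuousOn.uscWrt_eq (hu : UpperSemicontinuousOn u S)
    (hC : ∀ x ∈ S, |u x| ≤ C) {x : α} (hx : x ∈ S) : uscWrt S u x = u x :=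
  (le_of_forall_gt_imp_ge_of_dense fun c hc => uscWrt_le hC hx ((hu x hx c hc).mono fun _ h =>
    h.le)).antisymm (le_uscWrt hC hx)

end Envelope

/-! ### Reduction of the test functions to squared distances -/

section Cone

variable {Y : Type*} [MetricSpace Y] {S : Set Y} {ρ : Y → Y → ℝ}

theorem LocLipWrt.add {f g : Y → ℝ} (hf : LocLipWrt S ρ f)
    (hg : LocLipWrt S ρ g) : LocLipWrt S ρ (fun y => f y + g y) := by
  intro x hx
  obtain ⟨K, t, ht, hK⟩ := hf x hx
  obtain ⟨L, s, hs, hL⟩ := hg x hx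
  refine ⟨K + L, t ∩ s, inter_mem ht hs, ?_⟩
  rintro y ⟨⟨hyt, hys⟩, hy⟩ z ⟨⟨hzt, hzs⟩, hz⟩
  have h1 := hK y ⟨hyt, hy⟩ z ⟨hzt, hz⟩
  have h2 := hL y ⟨hys, hy⟩ z ⟨hzs, hz⟩
  calc |f y + g y - (f z + g z)| = |(f y - f z) + (g y - g z)| := by ring_nf
    _ ≤ |f y - f z| + |g y - g z| := abs_add_le _ _
    _ ≤ (K + L) * ρ y z := by linarith

theorem slopeWrt_add_le (h : IsMetricOn S ρ) {f g : Y → ℝ} (hf : LocLipWrt S ρ f)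
    (hg : LocLipWrt S ρ g) {x : Y} (hx : x ∈ S) :
    slopeWrt S ρ (fun y => f y + g y) x ≤ slopeWrt S ρ f x + slopeWrt S ρ g x := by
  refine le_of_forall_pos_le_add fun ε hε => ?_
  have hf0 := slopeWrt_nonneg h hx f
  have hg0 := slopeWrt_nonneg h hx g
  refine slopeWrt_le h hx (by positivity) ?_
  filter_upwards [hf.eventually_abs_le h hx (c := slopeWrt S ρ f x + ε / 2) (by linarith),
    hg.eventually_abs_le h hx (c := slopeWrt S ρ g x + ε / 2) (by linarith)] with y h1 h2
  calc |f y + g y - (f x + g x)| = |(f y - f x) + (g y - g x)| := by ring_nf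
    _ ≤ |f y - f x| + |g y - g x| := abs_add_le _ _
    _ ≤ _ := by linarith

/-- First-order condition at a minimum of `f₁ + f₂ + κ/2 * ρ(·, x)²`. -/
theorem abs_sub_slopeWrt_le_of_isLocalMin (hg : IsGeodesicWrt S ρ) (h : IsMetricOn S ρ)
    {f₁ f₂ : Y → ℝ} (h₁ : LocLipWrt S ρ f₁) (h₂ : LocLipWrt S ρ f₂) {κ : ℝ} (hκ : 0 ≤ κ) {x y : Y}
    (hx : x ∈ S) (hy : y ∈ S) (hlow : lowerSlopeWrt S ρ f₁ y = slopeWrt S ρ f₁ y)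
    (hmin : ∀ᶠ z in 𝓝[S] y,
      f₁ y + f₂ y + κ / 2 * ρ y x ^ 2 ≤ f₁ z + f₂ z + κ / 2 * ρ z x ^ 2) :
    |κ * ρ y x - slopeWrt S ρ f₁ y| ≤ slopeWrt S ρ f₂ y := by
  have hs₁ := slopeWrt_nonneg h hy f₁
  have hs₂ := slopeWrt_nonneg h hy f₂
  have hxy := h.nonneg hy hx
  have hmin' := hmin.filter_mono (nhdsWithin_mono y (sdiff_subset (t := {y})))
  rw [abs_le]
  constructor
  · suffices hle : lowerSlopeWrt S ρ f₁ y ≤ slopeWrt S ρ f₂ y + κ * ρ y x by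
      rw [hlow] at hle
      linarith
    refine le_of_forall_pos_le_add fun ε hε => lowerSlopeWrt_le h hy (by positivity) ?_
    have hsq := (locLipWrt_sq h hκ hx).eventually_abs_le h hy (c := κ * ρ y x + ε / 2)
      (by linarith [slopeWrt_sq_le h hκ hy hx])
    filter_upwards [hmin', hsq, h₂.eventually_abs_le h hy
      (c := slopeWrt S ρ f₂ y + ε / 2) (by linarith)] with z hz hz1 hz2
    rw [abs_le] at hz1 hz2
    linarith
  · rw [sub_le_iff_le_add]
    by_cases hne : y = x
    · rw [hne, h.refl x hx, ← hne]
      linarith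
    obtain ⟨γ, hγ, hγd⟩ := hg.exists_approach h hy hx hne
    refine le_of_forall_pos_le_add fun ε hε => ?_
    have e1 := hγ.eventually (h₁.eventually_abs_le h hy (c := slopeWrt S ρ f₁ y + ε / 2)
      (by linarith))
    have e2 := hγ.eventually (h₂.eventually_abs_le h hy (c := slopeWrt S ρ f₂ y + ε / 2)
      (by linarith))
    have hlim : Tendsto (fun t : ℝ => κ * ρ y x - κ / 2 * t) (𝓝[>] 0)
        (𝓝 (κ * ρ y x - κ / 2 * 0)) :=
      tendsto_nhdsWithin_of_tendsto_nhds (tendsto_const_nhds.sub (tendsto_id.const_mul _))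
    rw [mul_zero, sub_zero] at hlim
    refine le_of_tendsto hlim ?_
    filter_upwards [e1, e2, hγ.eventually hmin', hγd, self_mem_nhdsWithin]
      with t t1 t2 t3 t4 (t0 : 0 < t)
    rw [t4.1, abs_le] at t1 t2
    rw [t4.2] at t3
    refine le_of_mul_le_mul_right ?_ t0
    linarith

theorem isCompact_setOf_nonneg_abs_sub_le (a p : ℝ) : IsCompact {q : ℝ | 0 ≤ q ∧ |q - p| ≤ a} :=
  (isCompact_closedBall p a).inter_left isClosed_Ici

theorem continuousOn_section {H : Y → ℝ → ℝ → ℝ} (hH : ContinuousOn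
    (fun q : Y × ℝ × ℝ => H q.1 q.2.1 q.2.2) (S ×ˢ (univ : Set ℝ) ×ˢ Ici (0 : ℝ)))
    {x : Y} (hx : x ∈ S) (r a p : ℝ) : ContinuousOn (H x r) {q | 0 ≤ q ∧ |q - p| ≤ a} :=
  hH.comp (f := fun q : ℝ => (x, r, q)) (by fun_prop) fun _ hq => ⟨hx, mem_univ _, hq.1⟩

theorem Hlow_nonpos {H : Y → ℝ → ℝ → ℝ} (hH : ContinuousOn
    (fun q : Y × ℝ × ℝ => H q.1 q.2.1 q.2.2) (S ×ˢ (univ : Set ℝ) ×ˢ Ici (0 : ℝ)))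
    {x : Y} (hx : x ∈ S) {r a p q : ℝ} (hq0 : 0 ≤ q) (hq : |q - p| ≤ a) (hHq : H x r q ≤ 0) :
    Hlow H a x r p ≤ 0 :=
  (csInf_le ((isCompact_setOf_nonneg_abs_sub_le a p).bddBelow_image
    (continuousOn_section hH hx r a p)) (mem_image_of_mem _ ⟨hq0, hq⟩)).trans hHq

theorem exists_of_Hlow_nonpos {H : Y → ℝ → ℝ → ℝ} (hH : ContinuousOn
    (fun q : Y × ℝ × ℝ => H q.1 q.2.1 q.2.2) (S ×ˢ (univ : Set ℝ) ×ˢ Ici (0 : ℝ)))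
    {x : Y} (hx : x ∈ S) {r a p : ℝ} (ha : 0 ≤ a) (hp : 0 ≤ p) (hHl : Hlow H a x r p ≤ 0) :
    ∃ q, 0 ≤ q ∧ |q - p| ≤ a ∧ H x r q ≤ 0 := by
  obtain ⟨q, hq, hq'⟩ := ((isCompact_setOf_nonneg_abs_sub_le a p).image_of_continuousOn
    (continuousOn_section hH hx r a p)).sInf_mem ⟨_, mem_image_of_mem _ ⟨hp, by simpa using ha⟩⟩
  exact ⟨q, hq.1, hq.2, hq'.trans_le hHl⟩

/-- The subsolution condition restricted to the test functions `κ/2 * ρ(·, a)²`. -/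
def IsConeSubsolution (S : Set Y) (ρ : Y → Y → ℝ) (H : Y → ℝ → ℝ → ℝ) (v : Y → ℝ) : Prop :=
  ∀ κ : ℝ, 0 ≤ κ → ∀ a ∈ S, ∀ x ∈ S, IsLocalMaxOn (fun y => v y - κ / 2 * ρ y a ^ 2) S x →
    H x (v x) (κ * ρ x a) ≤ 0

theorem exists_penalized_max (h : IsMetricOn S ρ)
    {K : Set Y} (hK : IsCompact K) (hKS : K ⊆ S) (hKne : K.Nonempty) {v ψ : Y → ℝ}
    (hv : UpperSemicontinuousOn v S) (hψ : ContinuousOn ψ S) (κ : ℝ) :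
    ∃ x ∈ K, ∃ y ∈ K, ∀ x' ∈ K, ∀ y' ∈ K,
      v x' - ψ y' - κ / 2 * ρ y' x' ^ 2 ≤ v x - ψ y - κ / 2 * ρ y x ^ 2 := by
  have h1 : UpperSemicontinuousOn (fun z : Y × Y => v z.1) (K ×ˢ K) := by
    intro z hz c hc
    rw [show z = (z.1, z.2) from rfl, nhdsWithin_prod_eq]
    exact tendsto_fst.eventually ((hv z.1 (hKS hz.1) c hc).filter_mono (nhdsWithin_mono _ hKS))
  have h2 : ContinuousOn (fun z : Y × Y => -(ψ z.2) - κ / 2 * ρ z.2 z.1 ^ 2) (K ×ˢ K) := by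
    have hρ : ContinuousOn (fun z : Y × Y => ρ z.2 z.1) (K ×ˢ K) := fun z hz => by
      refine h.tendsto (hKS hz.2) (hKS hz.1) ?_ ?_ continuousWithinAt_snd continuousWithinAt_fst
      · exact eventually_mem_nhdsWithin.mono fun w hw => hKS hw.2
      · exact eventually_mem_nhdsWithin.mono fun w hw => hKS hw.1
    have hψ' : ContinuousOn (fun z : Y × Y => ψ z.2) (K ×ˢ K) :=
      hψ.comp continuousOn_snd fun z hz => hKS hz.2
    exact hψ'.neg.sub (continuousOn_const.mul (hρ.pow 2))
  obtain ⟨z, hz, hmax⟩ := (h1.add h2.upperSemicontinuousOn).exists_isMaxOn (hKne.prod hKne)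
    (hK.prod hK)
  refine ⟨z.1, hz.1, z.2, hz.2, fun x' hx' y' hy' => ?_⟩
  have := hmax (mk_mem_prod hx' hy')
  simp only [mem_ofPred_eq] at this
  linarith
/-- Testing an upper semicontinuous function against squared distances is enough. -/
theorem IsConeSubsolution.isMVSubsolutionWrt {H : Y → ℝ → ℝ → ℝ} {v : Y → ℝ} {C : ℝ}
    (hcone : IsConeSubsolution S ρ H v) (hS : IsCompact S) (hg : IsGeodesicWrt S ρ)
    (h : IsMetricOn S ρ) (hH : ContinuousOn (fun q : Y × ℝ × ℝ => H q.1 q.2.1 q.2.2)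
      (S ×ˢ (univ : Set ℝ) ×ˢ Ici (0 : ℝ)))
    (hv : UpperSemicontinuousOn v S) (hC : ∀ x ∈ S, |v x| ≤ C) :
    IsMVSubsolutionWrt S ρ H v := by
  intro ψ₁ ψ₂ h₁ h₂ x₀ hx₀ hmax
  obtain ⟨r, hr, hball⟩ : ∃ r > 0, ∀ y ∈ S, dist y x₀ ≤ r →
      v y - (ψ₁ y + ψ₂ y) ≤ v x₀ - (ψ₁ x₀ + ψ₂ x₀) := by
    obtain ⟨r, hr, hsub⟩ := (nhdsWithin_hasBasis nhds_basis_closedBall S).eventually_iff.1 hmax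
    refine ⟨r, hr, fun y hy hyr => ?_⟩
    have := hsub ⟨hyr, hy⟩
    beta_reduce at this
    rwa [hv.uscWrt_eq hC hy, hv.uscWrt_eq hC hx₀] at this
  rw [hv.uscWrt_eq hC hx₀]
  set f₂ : Y → ℝ := fun y => ψ₂ y + 1 / 2 * ρ y x₀ ^ 2 with hf₂
  have hL₂ : LocLipWrt S ρ f₂ := h₂.add (locLipWrt_sq h zero_le_one hx₀)
  have hψc : ContinuousOn (fun y => ψ₁ y + f₂ y) S :=
    (h₁.1.continuousOn h).add (hL₂.continuousOn h)
  have hf₂x₀ : f₂ x₀ = ψ₂ x₀ := by simp [hf₂, h.refl x₀ hx₀]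
  set K := S ∩ closedBall x₀ r with hKdef
  have hK : IsCompact K := hS.inter_right isClosed_closedBall
  have hx₀K : x₀ ∈ K := ⟨hx₀, mem_closedBall_self hr.le⟩
  choose x hx y hy hxy using fun n : ℕ =>
    exists_penalized_max h hK inter_subset_left ⟨x₀, hx₀K⟩ hv hψc (n : ℝ)
  have hbase : ∀ n, v x₀ - (ψ₁ x₀ + ψ₂ x₀) + n / 2 * ρ (y n) (x n) ^ 2 ≤
      v (x n) - (ψ₁ (y n) + f₂ (y n)) := fun n => by
    have := hxy n x₀ hx₀K x₀ hx₀K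
    simp only [h.refl x₀ hx₀, hf₂x₀] at this
    linarith
  have hbase' : ∀ n, v x₀ - (ψ₁ x₀ + ψ₂ x₀) + (ψ₁ (y n) + f₂ (y n)) ≤ v (x n) := fun n => by
    have h0 : 0 ≤ (n : ℝ) / 2 * ρ (y n) (x n) ^ 2 := by positivity
    linarith [hbase n]
  obtain ⟨M, hM⟩ := hK.exists_bound_of_continuousOn (hψc.mono inter_subset_left)
  have hdist : Tendsto (fun n => dist (y n) (x n)) atTop (𝓝 0) := by
    have hsq : Tendsto (fun n => dist (y n) (x n) ^ 2) atTop (𝓝 0) := by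
      refine squeeze_zero' (Eventually.of_forall fun _ => sq_nonneg _) ?_
        (tendsto_const_div_atTop_nhds_zero_nat (2 * (2 * C + 2 * M)))
      filter_upwards [eventually_gt_atTop 0] with n hn
      have hn' : (0 : ℝ) < n := Nat.cast_pos.2 hn
      have b1 := abs_le.1 (hC x₀ hx₀)
      have b2 := abs_le.1 (hC _ (hx n).1)
      have b3 := abs_le.1 (hM x₀ hx₀K)
      have b4 := abs_le.1 (hM _ (hy n))
      rw [hf₂x₀] at b3
      have b5 := hbase n
      have b6 : dist (y n) (x n) ^ 2 ≤ ρ (y n) (x n) ^ 2 :=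
        pow_le_pow_left₀ dist_nonneg (h.ge_dist _ (hy n).1 _ (hx n).1) 2
      refine b6.trans ?_
      rw [le_div_iff₀ hn']
      linarith
    have := hsq.sqrt
    simpa [Real.sqrt_sq dist_nonneg] using this
  obtain ⟨p, hp, φ, hφ, hyp⟩ := hK.tendsto_subseq hy
  have hxp : Tendsto (x ∘ φ) atTop (𝓝 p) :=
    (tendsto_iff_of_dist (hdist.comp hφ.tendsto_atTop)).1 hyp
  have hψp : Tendsto (fun k => v x₀ - (ψ₁ x₀ + ψ₂ x₀) + (ψ₁ (y (φ k)) + f₂ (y (φ k)))) atTop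
      (𝓝 (v x₀ - (ψ₁ x₀ + ψ₂ x₀) + (ψ₁ p + f₂ p))) :=
    ((hψc p hp.1).tendsto.comp (tendsto_nhdsWithin_iff.2
      ⟨hyp, Eventually.of_forall fun k => (hy (φ k)).1⟩)).const_add _
  have husc : ∀ c > v p, ∀ᶠ k in atTop, v (x (φ k)) < c := fun c hc =>
    (tendsto_nhdsWithin_iff.2 ⟨hxp, Eventually.of_forall fun k => (hx (φ k)).1⟩).eventually
      (hv p hp.1 c hc)
  obtain rfl : p = x₀ := by
    refine h.eq_of_le_zero hp.1 hx₀ ?_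
    have hle : v x₀ - (ψ₁ x₀ + ψ₂ x₀) + (ψ₁ p + f₂ p) ≤ v p :=
      le_of_forall_gt_imp_ge_of_dense fun c hc => le_of_tendsto hψp
        ((husc c hc).mono fun k hk => (hbase' _).trans hk.le)
    have hmaxp := hball p hp.1 hp.2
    simp only [hf₂] at hle
    have : ρ p x₀ ^ 2 ≤ 0 := by linarith
    exact (pow_eq_zero_iff two_ne_zero).1 (this.antisymm (sq_nonneg _)) |>.le
  have hvx : Tendsto (fun k => v (x (φ k))) atTop (𝓝 (v p)) := by
    rw [hf₂x₀, sub_add_cancel] at hψp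
    exact tendsto_order.2 ⟨fun c hc => (hψp.eventually_const_lt hc).mono fun k hk =>
      hk.trans_le (hbase' _), husc⟩
  have hnhds : ∀ {z : ℕ → Y}, (∀ k, z k ∈ K) → Tendsto z atTop (𝓝 p) →
      ∀ᶠ k in atTop, ∀ᶠ w in 𝓝[S] (z k), w ∈ K := fun {z} hzK hz => by
    filter_upwards [hz.eventually (ball_mem_nhds p hr)] with k hk
    filter_upwards [self_mem_nhdsWithin, mem_nhdsWithin_of_mem_nhds (isOpen_ball.mem_nhds hk)]
      with w hw hw'
    exact ⟨hw, ball_subset_closedBall hw'⟩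
  set s := slopeWrt S ρ ψ₁ p with hs
  set A := uscWrt S (slopeWrt S ρ ψ₂) p with hA
  have hys : Tendsto (fun k => y (φ k)) atTop (𝓝[S] p) :=
    tendsto_nhdsWithin_iff.2 ⟨hyp, Eventually.of_forall fun k => (hy (φ k)).1⟩
  have hsol : ∀ᶠ k in atTop, H (x (φ k)) (v (x (φ k))) (φ k * ρ (y (φ k)) (x (φ k))) ≤ 0 := by
    filter_upwards [hnhds (fun k => hx (φ k)) hxp] with k hk
    have hS' := (hx (φ k)).1
    rw [h.symm _ (hy (φ k)).1 _ hS']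
    refine hcone _ (Nat.cast_nonneg _) _ (hy (φ k)).1 _ hS' ?_
    filter_upwards [hk] with w hw
    have := hxy (φ k) w hw _ (hy (φ k))
    rw [h.symm _ (hy (φ k)).1 _ hS', h.symm _ (hy (φ k)).1 _ hw.1] at this
    linarith
  have hbd : ∀ ε > 0, ∀ᶠ k in atTop, |φ k * ρ (y (φ k)) (x (φ k)) - s| ≤ A + ε := by
    intro ε hε
    obtain ⟨B, hB⟩ := h₂.exists_eventually_slopeWrt_le h hx₀
    have e1 : ∀ᶠ z in 𝓝[S] p, slopeWrt S ρ ψ₂ z < A + ε / 3 :=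
      eventually_lt_of_limsup_lt (show A < A + ε / 3 by linarith)
        (isBoundedUnder_of_eventually_le hB)
    have e2 : ∀ᶠ z in 𝓝[S] p, ρ z p < ε / 3 :=
      (h.continuousOn hx₀ p hx₀).eventually_lt_const (by beta_reduce; rw [h.refl p hx₀]; positivity)
    have e3 : ∀ᶠ z in 𝓝[S] p, |slopeWrt S ρ ψ₁ z - s| < ε / 3 :=
      (h₁.2.1 p hx₀).eventually (Metric.ball_mem_nhds _ (by positivity))
    filter_upwards [hys.eventually e1, hys.eventually e2, hys.eventually e3,
      hnhds (fun k => hy (φ k)) hyp] with k k1 k2 k3 k4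
    have hyS := (hy (φ k)).1
    have hfirst := abs_sub_slopeWrt_le_of_isLocalMin hg h h₁.1 hL₂ (Nat.cast_nonneg (φ k))
      (hx (φ k)).1 hyS (h₁.2.2 _ hyS) (by
        filter_upwards [k4] with w hw
        linarith [hxy (φ k) _ (hx (φ k)) w hw])
    have hadd := slopeWrt_add_le h h₂ (locLipWrt_sq h zero_le_one hx₀) hyS
    have hsq := slopeWrt_sq_le h zero_le_one hyS hx₀
    calc _ ≤ |φ k * ρ (y (φ k)) (x (φ k)) - slopeWrt S ρ ψ₁ (y (φ k))| +
          |slopeWrt S ρ ψ₁ (y (φ k)) - s| := _root_.abs_sub_le _ _ _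
      _ ≤ A + ε := by linarith
  obtain ⟨q, -, θ, hθ, hq⟩ := (isCompact_closedBall s (A + 1)).tendsto_subseq'
    (hbd 1 one_pos).frequently
  have hP0 : ∀ k, 0 ≤ (φ k : ℝ) * ρ (y (φ k)) (x (φ k)) := fun k =>
    mul_nonneg (Nat.cast_nonneg _) (h.nonneg (hy _).1 (hx _).1)
  have hq0 : 0 ≤ q := ge_of_tendsto' hq fun k => hP0 (θ k)
  have hqA : |q - s| ≤ A := le_of_forall_pos_le_add fun ε hε =>
    le_of_tendsto ((hq.sub_const s).abs) (hθ.tendsto_atTop.eventually (hbd ε hε))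
  refine Hlow_nonpos hH hx₀ hq0 hqA ?_
  have hlim := (hH (p, v p, q) ⟨hx₀, mem_univ _, hq0⟩).tendsto.comp (tendsto_nhdsWithin_iff.2
    ⟨(hxp.comp hθ.tendsto_atTop).prodMk_nhds ((hvx.comp hθ.tendsto_atTop).prodMk_nhds hq),
      Eventually.of_forall fun k => ⟨(hx (φ (θ k))).1, mem_univ _, hP0 (θ k)⟩⟩)
  exact le_of_tendsto hlim (hθ.tendsto_atTop.eventually hsol)

end Cone

/-! ### Convergence along varying sets -/

section Approach

variable {Z : Type*} {S : ℕ → Set Z} {z : Z}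

/-- The filter of pairs `(n, w)` with `n → ∞`, `w → z` and `w ∈ S n`. -/
def approachFilter [TopologicalSpace Z] (S : ℕ → Set Z) (z : Z) : Filter (ℕ × Z) :=
  (atTop ×ˢ 𝓝 z) ⊓ 𝓟 {q | q.2 ∈ S q.1}

theorem tendsto_approachFilter [TopologicalSpace Z] {ι : Type*} {l : Filter ι} {φ : ι → ℕ}
    {w : ι → Z} (hφ : Tendsto φ l atTop) (hw : Tendsto w l (𝓝 z)) (hS : ∀ᶠ i in l, w i ∈ S (φ i)) :
    Tendsto (fun i => (φ i, w i)) l (approachFilter S z) :=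
  tendsto_inf.2 ⟨hφ.prodMk hw, tendsto_principal.2 hS⟩

theorem eventually_mem_approachFilter [TopologicalSpace Z] :
    ∀ᶠ q in approachFilter S z, q.2 ∈ S q.1 :=
  mem_inf_of_right (mem_principal_self _)

variable [PseudoMetricSpace Z]

theorem eventually_approachFilter_iff {P : ℕ × Z → Prop} :
    (∀ᶠ q in approachFilter S z, P q) ↔
      ∃ N : ℕ, ∃ δ > 0, ∀ n ≥ N, ∀ w ∈ S n, dist w z < δ → P (n, w) := by
  rw [approachFilter, eventually_inf_principal,
    (atTop_basis.prod (nhds_basis_ball (x := z))).eventually_iff]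
  constructor
  · rintro ⟨⟨N, δ⟩, ⟨-, hδ⟩, hP⟩
    exact ⟨N, δ, hδ, fun n hn w hw hwz => hP (x := (n, w)) ⟨hn, hwz⟩ hw⟩
  · rintro ⟨N, δ, hδ, hP⟩
    exact ⟨(N, δ), ⟨trivial, hδ⟩, fun q hq hqS => hP q.1 hq.1 q.2 hqS hq.2⟩

/-- Convergence along every sequence `zₙ ∈ S n` with `zₙ → z` gives convergence along
`approachFilter S z`. -/
theorem tendsto_approachFilter_of_seq {f : ℕ → Z → ℝ} {L : ℝ} {z₀ : ℕ → Z} (hz₀ : ∀ n, z₀ n ∈ S n)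
    (hz₀z : Tendsto z₀ atTop (𝓝 z))
    (hf : ∀ w : ℕ → Z, (∀ n, w n ∈ S n) → Tendsto w atTop (𝓝 z) →
      Tendsto (fun n => f n (w n)) atTop (𝓝 L)) :
    Tendsto (fun q : ℕ × Z => f q.1 q.2) (approachFilter S z) (𝓝 L) := by
  intro U hU
  rw [mem_map]
  by_contra hcon
  have hfreq : ∀ k : ℕ, ∃ᶠ n in atTop,
      ∃ w ∈ S n, dist w z < 1 / ((k : ℝ) + 1) ∧ f n w ∉ U := by
    intro k
    rw [frequently_atTop]
    by_contra! hk
    obtain ⟨N, hN⟩ := hk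
    exact hcon (eventually_approachFilter_iff.2 ⟨N, 1 / ((k : ℝ) + 1), Nat.one_div_pos_of_nat,
      fun n hn w hw hwz => hN n hn w hw hwz⟩)
  obtain ⟨φ, hφ, hφP⟩ := extraction_forall_of_frequently hfreq
  choose w hwS hwz hwU using hφP
  have hwlim : Tendsto w atTop (𝓝 z) := tendsto_iff_dist_tendsto_zero.2
    (squeeze_zero (fun _ => dist_nonneg) (fun k => (hwz k).le) tendsto_one_div_add_atTop_nhds_zero_nat)
  have hext := hf (Function.extend φ w z₀) (fun n => ?_) ?_
  · obtain ⟨k, hk⟩ := ((hext.comp hφ.tendsto_atTop).eventually hU).exists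
    rw [Function.comp, hφ.injective.extend_apply] at hk
    exact hwU k hk
  · by_cases hn : ∃ k, φ k = n
    · obtain ⟨k, rfl⟩ := hn
      rw [hφ.injective.extend_apply]
      exact hwS k
    · rw [Function.extend_apply' _ _ _ hn]
      exact hz₀ n
  · intro V hV
    obtain ⟨K, hK⟩ := eventually_atTop.1 (hwlim.eventually hV)
    rw [mem_map]
    filter_upwards [hz₀z.eventually hV, eventually_ge_atTop (φ K)] with n hn hnK
    by_cases hn' : ∃ k, φ k = n
    · obtain ⟨k, rfl⟩ := hn'
      rw [mem_preimage, hφ.injective.extend_apply]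
      exact hK k (hφ.le_iff_le.1 hnK)
    · rw [mem_preimage, Function.extend_apply' _ _ _ hn']
      exact hn

end Approach

section Semilimit

variable {Y : Type*} [MetricSpace Y] {X : ℕ → Set Y} {u : ℕ → Y → ℝ} {C : ℝ}

/-- The upper semilimit of `u n` along the sets `X n`. -/
noncomputable def upperSemilimit (X : ℕ → Set Y) (u : ℕ → Y → ℝ) (x : Y) : ℝ :=
  limsup (fun q : ℕ × Y => u q.1 q.2) (approachFilter X x)

theorem isBoundedUnder_le_approachFilter (hC : ∀ n, ∀ x ∈ X n, |u n x| ≤ C) (x : Y) :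
    IsBoundedUnder (· ≤ ·) (approachFilter X x) (fun q : ℕ × Y => u q.1 q.2) :=
  isBoundedUnder_of_eventually_le (eventually_mem_approachFilter.mono fun q hq =>
    (le_abs_self _).trans (hC q.1 q.2 hq))

theorem isBoundedUnder_ge_approachFilter (hC : ∀ n, ∀ x ∈ X n, |u n x| ≤ C) (x : Y) :
    IsBoundedUnder (· ≥ ·) (approachFilter X x) (fun q : ℕ × Y => u q.1 q.2) :=
  isBoundedUnder_of_eventually_ge (eventually_mem_approachFilter.mono fun q hq =>
    (abs_le.1 (hC q.1 q.2 hq)).1)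

theorem upperSemilimit_le (hC : ∀ n, ∀ x ∈ X n, |u n x| ≤ C) {x : Y}
    (hx : (approachFilter X x).NeBot) {c : ℝ} (h : ∀ᶠ q in approachFilter X x, u q.1 q.2 ≤ c) :
    upperSemilimit X u x ≤ c :=
  limsup_le_of_le (isBoundedUnder_ge_approachFilter hC x).isCoboundedUnder_le h

theorem eventually_lt_of_upperSemilimit_lt (hC : ∀ n, ∀ x ∈ X n, |u n x| ≤ C) {x : Y} {c : ℝ}
    (h : upperSemilimit X u x < c) : ∀ᶠ q in approachFilter X x, u q.1 q.2 < c :=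
  eventually_lt_of_limsup_lt h (isBoundedUnder_le_approachFilter hC x)

theorem abs_upperSemilimit_le (hC : ∀ n, ∀ x ∈ X n, |u n x| ≤ C) {x : Y}
    (hx : (approachFilter X x).NeBot) : |upperSemilimit X u x| ≤ C := by
  refine abs_le.2 ⟨le_limsup_of_frequently_le ?_ (isBoundedUnder_le_approachFilter hC x),
    upperSemilimit_le hC hx ?_⟩
  · exact (eventually_mem_approachFilter.mono fun q hq => (abs_le.1 (hC _ _ hq)).1).frequently
  · exact eventually_mem_approachFilter.mono fun q hq => (le_abs_self _).trans (hC _ _ hq)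

theorem upperSemicontinuousOn_upperSemilimit {Xi : Set Y} (hC : ∀ n, ∀ x ∈ X n, |u n x| ≤ C)
    (hXi : ∀ x ∈ Xi, (approachFilter X x).NeBot) :
    UpperSemicontinuousOn (upperSemilimit X u) Xi := by
  intro x hx c hc
  obtain ⟨c', hc1, hc2⟩ := exists_between hc
  obtain ⟨N, δ, hδ, hN⟩ :=
    eventually_approachFilter_iff.1 (eventually_lt_of_upperSemilimit_lt hC hc1)
  filter_upwards [self_mem_nhdsWithin, mem_nhdsWithin_of_mem_nhds (ball_mem_nhds x hδ)]
    with y hy hyx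
  refine (upperSemilimit_le hC (hXi y hy) (eventually_approachFilter_iff.2
    ⟨N, δ - dist y x, sub_pos.2 hyx, fun n hn w hw hwy => (hN n hn w hw ?_).le⟩)).trans_lt hc2
  linarith [dist_triangle w y x]

theorem eventually_uscWrt_lt (hC : ∀ n, ∀ x ∈ X n, |u n x| ≤ C) {x : Y} {c : ℝ}
    (hc : upperSemilimit X u x < c) :
    ∀ᶠ q in approachFilter X x, uscWrt (X q.1) (u q.1) q.2 < c := by
  obtain ⟨c', hc1, hc2⟩ := exists_between hc
  obtain ⟨N, δ, hδ, hN⟩ :=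
    eventually_approachFilter_iff.1 (eventually_lt_of_upperSemilimit_lt hC hc1)
  refine eventually_approachFilter_iff.2 ⟨N, δ, hδ, fun n hn w hw hwx =>
    (uscWrt_le (hC n) hw ?_).trans_lt hc2⟩
  filter_upwards [self_mem_nhdsWithin, mem_nhdsWithin_of_mem_nhds (isOpen_ball.mem_nhds hwx)]
    with y hy hyx
  exact (hN n hn y hy hyx).le

/-- The upper semilimit of subsolutions satisfies the limit inequality for squared distances. -/
theorem isConeSubsolution_upperSemilimit {Xi : Set Y} {d : ℕ → Y → Y → ℝ} {di : Y → Y → ℝ}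
    {H : ℕ → Y → ℝ → ℝ → ℝ} {Hi : Y → ℝ → ℝ → ℝ} (hXc : ∀ n, IsCompact (X n))
    (hmet : ∀ n, IsMetricOn (X n) (d n)) (hgeo : ∀ n, IsGeodesicWrt (X n) (d n))
    (hmeti : IsMetricOn Xi di)
    (hHc : ∀ n, ContinuousOn (fun q : Y × ℝ × ℝ => H n q.1 q.2.1 q.2.2)
      (X n ×ˢ (univ : Set ℝ) ×ˢ Ici (0 : ℝ)))
    (happ : ∀ x ∈ Xi, ∃ xn : ℕ → Y, (∀ n, xn n ∈ X n) ∧ Tendsto xn atTop (𝓝 x))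
    (hcpt : ∀ φ : ℕ → ℕ, Tendsto φ atTop atTop → ∀ x : ℕ → Y, (∀ k, x k ∈ X (φ k)) →
      ∃ p ∈ Xi, ∃ θ : ℕ → ℕ, StrictMono θ ∧ Tendsto (x ∘ θ) atTop (𝓝 p))
    (hd : ∀ a ∈ Xi, ∀ b ∈ Xi, Tendsto (fun q : ℕ × Y × Y => d q.1 q.2.1 q.2.2)
      (approachFilter (fun n => X n ×ˢ X n) (a, b)) (𝓝 (di a b)))
    (hH : ∀ x ∈ Xi, ∀ r p : ℝ, 0 ≤ p →
      Tendsto (fun q : ℕ × Y × ℝ × ℝ => H q.1 q.2.1 q.2.2.1 q.2.2.2)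
        (approachFilter (fun n => X n ×ˢ (univ : Set ℝ) ×ˢ Ici (0 : ℝ)) (x, r, p))
        (𝓝 (Hi x r p)))
    (hC : ∀ n, ∀ x ∈ X n, |u n x| ≤ C) (hsub : ∀ n, IsMVSubsolutionWrt (X n) (d n) (H n) (u n))
    (hXi : ∀ x ∈ Xi, (approachFilter X x).NeBot) :
    IsConeSubsolution Xi di Hi (upperSemilimit X u) := by
  intro κ hκ a ha x₀ hx₀ hmax
  set V := upperSemilimit X u with hV
  have := hXi x₀ hx₀
  obtain ⟨r, hr, hball⟩ : ∃ r > 0, ∀ y ∈ Xi, dist y x₀ ≤ r →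
      V y - κ / 2 * di y a ^ 2 ≤ V x₀ - κ / 2 * di x₀ a ^ 2 := by
    obtain ⟨r, hr, hsub⟩ := (nhdsWithin_hasBasis nhds_basis_closedBall Xi).eventually_iff.1 hmax
    exact ⟨r, hr, fun y hy hyr => hsub ⟨hyr, hy⟩⟩
  have hseq : ∀ k : ℕ, ∃ n ≥ k, ∃ z ∈ X n, dist z x₀ < min r (1 / ((k : ℝ) + 1)) ∧
      V x₀ - 1 / ((k : ℝ) + 1) < u n z := by
    intro k
    have hk : (0 : ℝ) < 1 / ((k : ℝ) + 1) := Nat.one_div_pos_of_nat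
    have hf : ∃ᶠ q in approachFilter X x₀, V x₀ - 1 / ((k : ℝ) + 1) < u q.1 q.2 :=
      frequently_lt_of_lt_limsup (isBoundedUnder_ge_approachFilter hC x₀).isCoboundedUnder_le
        (sub_lt_self _ hk)
    have he : ∀ᶠ q in approachFilter X x₀,
        q.1 ≥ k ∧ q.2 ∈ X q.1 ∧ dist q.2 x₀ < min r (1 / ((k : ℝ) + 1)) :=
      eventually_approachFilter_iff.2 ⟨k, _, lt_min hr hk, fun n hn w hw hwx => ⟨hn, hw, hwx⟩⟩
    obtain ⟨q, h1, h2, h3, h4⟩ := (hf.and_eventually he).exists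
    exact ⟨q.1, h2, q.2, h3, h4, h1⟩
  choose n hn z hz hzx₀ hzu using hseq
  have hntop : Tendsto n atTop atTop := tendsto_atTop_mono hn tendsto_id
  have hzlim : Tendsto z atTop (𝓝 x₀) := tendsto_iff_dist_tendsto_zero.2
    (squeeze_zero (fun _ => dist_nonneg) (fun k => ((hzx₀ k).trans_le (min_le_right _ _)).le)
      tendsto_one_div_add_atTop_nhds_zero_nat)
  obtain ⟨α, hαX, hα⟩ := happ a ha
  set b : ℕ → Y := fun k => α (n k) with hb
  have hbX : ∀ k, b k ∈ X (n k) := fun k => hαX _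
  have hblim : Tendsto b atTop (𝓝 a) := hα.comp hntop
  set W : ℕ → Y → ℝ := fun k => uscWrt (X (n k)) (u (n k)) with hW
  have hex : ∀ k, ∃ x ∈ X (n k) ∩ closedBall x₀ r, ∀ y ∈ X (n k) ∩ closedBall x₀ r,
      W k y - (κ / 2 * d (n k) y (b k) ^ 2 + 1 / 2 * d (n k) y (z k) ^ 2) ≤
      W k x - (κ / 2 * d (n k) x (b k) ^ 2 + 1 / 2 * d (n k) x (z k) ^ 2) := by
    intro k
    have hm := hmet (n k)
    have hc : ContinuousOn (fun y => -(κ / 2 * d (n k) y (b k) ^ 2 + 1 / 2 * d (n k) y (z k) ^ 2))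
        (X (n k)) :=
      (((locLipWrt_sq hm hκ (hbX k)).continuousOn hm).add
        ((locLipWrt_sq hm zero_le_one (hz k)).continuousOn hm)).neg
    have hne : (X (n k) ∩ closedBall x₀ r).Nonempty :=
      ⟨z k, hz k, ((hzx₀ k).trans_le (min_le_left _ _)).le⟩
    obtain ⟨x, hx, hxmax⟩ := (((upperSemicontinuousOn_uscWrt (hC (n k))).add
      hc.upperSemicontinuousOn).mono inter_subset_left).exists_isMaxOn hne
      ((hXc (n k)).inter_right isClosed_closedBall)
    exact ⟨x, hx, fun y hy => by simpa only [← sub_eq_add_neg, mem_ofPred_eq] using hxmax hy⟩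
  choose x hx hxmax using hex
  have hxX : ∀ k, x k ∈ X (n k) := fun k => (hx k).1
  have hbase : ∀ k : ℕ, V x₀ - 1 / ((k : ℝ) + 1) - κ / 2 * d (n k) (z k) (b k) ^ 2 +
      (κ / 2 * d (n k) (x k) (b k) ^ 2 + 1 / 2 * d (n k) (x k) (z k) ^ 2) ≤ W k (x k) := by
    intro k
    have h1 := hxmax k (z k) ⟨hz k, ((hzx₀ k).trans_le (min_le_left _ _)).le⟩
    rw [(hmet (n k)).refl _ (hz k)] at h1
    have h2 : u (n k) (z k) ≤ W k (z k) := le_uscWrt (hC (n k)) (hz k)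
    linarith [hzu k]
  obtain ⟨p, hp, θ, hθ, hxp⟩ := hcpt n hntop x hxX
  have hθt := hθ.tendsto_atTop
  have hpr : dist p x₀ ≤ r := isClosed_closedBall.mem_of_tendsto hxp
    (Eventually.of_forall fun k => (hx (θ k)).2)
  have hdlim : ∀ {f g : ℕ → Y} {y w : Y}, y ∈ Xi → w ∈ Xi → (∀ k, f k ∈ X (n k)) →
      (∀ k, g k ∈ X (n k)) → Tendsto (f ∘ θ) atTop (𝓝 y) → Tendsto (g ∘ θ) atTop (𝓝 w) →
      Tendsto (fun k => d (n (θ k)) (f (θ k)) (g (θ k))) atTop (𝓝 (di y w)) :=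
    fun hy hw hf hg hfy hgw => (hd _ hy _ hw).comp (tendsto_approachFilter (hntop.comp hθt)
      (hfy.prodMk_nhds hgw) (Eventually.of_forall fun k => ⟨hf _, hg _⟩))
  have hzb := hdlim hx₀ ha hz hbX (hzlim.comp hθt) (hblim.comp hθt)
  have hxb := hdlim hp ha hxX hbX hxp (hblim.comp hθt)
  have hxz := hdlim hp hx₀ hxX hz hxp (hzlim.comp hθt)
  have hlow : Tendsto (fun k => V x₀ - 1 / ((θ k : ℝ) + 1)
      - κ / 2 * d (n (θ k)) (z (θ k)) (b (θ k)) ^ 2 +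
      (κ / 2 * d (n (θ k)) (x (θ k)) (b (θ k)) ^ 2
        + 1 / 2 * d (n (θ k)) (x (θ k)) (z (θ k)) ^ 2)) atTop
      (𝓝 (V x₀ - 0 - κ / 2 * di x₀ a ^ 2 + (κ / 2 * di p a ^ 2 + 1 / 2 * di p x₀ ^ 2))) :=
    (((tendsto_one_div_add_atTop_nhds_zero_nat.comp hθt).const_sub _).sub
      ((hzb.pow 2).const_mul _)).add (((hxb.pow 2).const_mul _).add ((hxz.pow 2).const_mul _))
  have husc : ∀ c > V p, ∀ᶠ k in atTop, W (θ k) (x (θ k)) < c := fun c hc =>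
    (tendsto_approachFilter (hntop.comp hθt) hxp (Eventually.of_forall fun k => hxX _)).eventually
      (eventually_uscWrt_lt hC hc)
  obtain rfl : p = x₀ := by
    refine hmeti.eq_of_le_zero hp hx₀ ?_
    have hle := le_of_forall_gt_imp_ge_of_dense fun c hc => le_of_tendsto hlow
      ((husc c hc).mono fun k hk => (hbase (θ k)).trans hk.le)
    have hmaxp := hball p hp hpr
    have : di p x₀ ^ 2 ≤ 0 := by linarith
    exact (pow_eq_zero_iff two_ne_zero).1 (this.antisymm (sq_nonneg _)) |>.le
  have hWx : Tendsto (fun k => W (θ k) (x (θ k))) atTop (𝓝 (V p)) := by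
    refine tendsto_order.2 ⟨fun c hc => ?_, husc⟩
    refine (hlow.eventually_const_lt ?_).mono fun k hk => hk.trans_le (hbase (θ k))
    rw [hmeti.refl p hp]
    linarith
  have hq : ∀ᶠ k in atTop, ∃ q, 0 ≤ q ∧
      |q - κ * d (n (θ k)) (x (θ k)) (b (θ k))| ≤ d (n (θ k)) (x (θ k)) (z (θ k)) ∧
      H (n (θ k)) (x (θ k)) (W (θ k) (x (θ k))) q ≤ 0 := by
    filter_upwards [hxp.eventually (ball_mem_nhds p hr)] with k hk
    have hm := hmet (n (θ k))
    have hg := hgeo (n (θ k))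
    have hs := hsub (n (θ k)) _ _ (isC1MinusWrt_sq hg hm hκ (hbX (θ k)))
      (locLipWrt_sq hm zero_le_one (hz (θ k))) _ (hxX (θ k)) (by
        filter_upwards [self_mem_nhdsWithin,
          mem_nhdsWithin_of_mem_nhds (isOpen_ball.mem_nhds hk)] with y hy hyr
        exact hxmax (θ k) y ⟨hy, ball_subset_closedBall hyr⟩)
    have hslope : uscWrt (X (n (θ k))) (slopeWrt (X (n (θ k))) (d (n (θ k)))
        (fun y => 1 / 2 * d (n (θ k)) y (z (θ k)) ^ 2)) (x (θ k)) =
        d (n (θ k)) (x (θ k)) (z (θ k)) := by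
      have := nhdsWithin_neBot_of_mem (hxX (θ k))
      rw [uscWrt, ((isC1MinusWrt_sq hg hm zero_le_one (hz (θ k))).2.1 _ (hxX (θ k))).limsup_eq,
        slopeWrt_sq hg hm zero_le_one (hxX _) (hz _), one_mul]
    rw [hslope, slopeWrt_sq hg hm hκ (hxX _) (hbX _)] at hs
    exact exists_of_Hlow_nonpos (hHc _) (hxX _) (hm.nonneg (hxX _) (hz _))
      (mul_nonneg hκ (hm.nonneg (hxX _) (hbX _))) hs
  obtain ⟨q, hq⟩ := hq.choice
  have hqlim : Tendsto q atTop (𝓝 (κ * di p a)) := by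
    rw [hmeti.refl p hp] at hxz
    have h0 : Tendsto (fun k => q k - κ * d (n (θ k)) (x (θ k)) (b (θ k))) atTop (𝓝 0) :=
      squeeze_zero_norm' (hq.mono fun k hk => hk.2.1) hxz
    simpa using h0.add (hxb.const_mul κ)
  exact le_of_tendsto ((hH p hp (V p) _ (mul_nonneg hκ (hmeti.nonneg hp ha))).comp
    (tendsto_approachFilter (hntop.comp hθt) (hxp.prodMk_nhds (hWx.prodMk_nhds hqlim))
      (hq.mono fun k hk => ⟨hxX _, mem_univ _, hk.1⟩))) (hq.mono fun k hk => hk.2.2)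

end Semilimit

/-! ### Changing the sign of the unknown -/

section Neg

theorem Hlow_neg {Z : Type*} (H : Z → ℝ → ℝ → ℝ) (a : ℝ) (x : Z) (r p : ℝ) :
    Hlow (fun x r p => -H x (-r) p) a x (-r) p = -Hupp H a x r p := by
  rw [Hlow, Hupp, ← Real.sInf_neg, ← image_neg_eq_neg, image_image]
  simp only [neg_neg]

variable {Y : Type*} [MetricSpace Y] {S : Set Y} {ρ : Y → Y → ℝ} {H : Y → ℝ → ℝ → ℝ} {u : Y → ℝ}

theorem uscWrt_neg (S : Set Y) (u : Y → ℝ) (x : Y) :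
    uscWrt S (fun y => -u y) x = -lscWrt S u x :=
  real_limsup_neg _ _

theorem slopeWrt_neg (S : Set Y) (ρ : Y → Y → ℝ) (u : Y → ℝ) :
    slopeWrt S ρ (fun y => -u y) = slopeWrt S ρ u := by
  funext x
  simp only [slopeWrt, ← neg_sub', abs_neg]

theorem lowerSlopeWrt_neg (S : Set Y) (ρ : Y → Y → ℝ) (u : Y → ℝ) :
    lowerSlopeWrt S ρ (fun y => -u y) = upperSlopeWrt S ρ u := by
  funext x
  simp only [lowerSlopeWrt, upperSlopeWrt, neg_sub_neg]

theorem LocLipWrt.neg (hu : LocLipWrt S ρ u) : LocLipWrt S ρ (fun y => -u y) := by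
  intro x hx
  obtain ⟨K, t, ht, hK⟩ := hu x hx
  refine ⟨K, t, ht, fun y hy z hz => ?_⟩
  rw [← neg_sub', abs_neg]
  exact hK y hy z hz

theorem IsC1PlusWrt.neg (hu : IsC1PlusWrt S ρ u) : IsC1MinusWrt S ρ (fun y => -u y) := by
  refine ⟨hu.1.neg, ?_⟩
  rw [slopeWrt_neg, lowerSlopeWrt_neg]
  exact hu.2

theorem IsC1MinusWrt.neg (hu : IsC1MinusWrt S ρ u) : IsC1PlusWrt S ρ (fun y => -u y) := by
  refine ⟨hu.1.neg, ?_⟩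
  rw [slopeWrt_neg, ← lowerSlopeWrt_neg]
  simpa only [neg_neg] using hu.2

theorem IsMVSubsolutionWrt.of_neg
    (hu : IsMVSubsolutionWrt S ρ (fun x r p => -H x (-r) p) (fun y => -u y)) :
    IsMVSupersolutionWrt S ρ H u := by
  intro ψ₁ ψ₂ h₁ h₂ x hx hmin
  have := hu _ _ h₁.neg h₂.neg x hx (by
    filter_upwards [hmin] with y hy
    simp only [uscWrt_neg]
    linarith)
  rwa [slopeWrt_neg, slopeWrt_neg, uscWrt_neg, Hlow_neg, neg_nonpos] at this

theorem IsMVSupersolutionWrt.neg (hu : IsMVSupersolutionWrt S ρ H u) :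
    IsMVSubsolutionWrt S ρ (fun x r p => -H x (-r) p) (fun y => -u y) := by
  intro ψ₁ ψ₂ h₁ h₂ x hx hmax
  have := hu _ _ h₁.neg h₂.neg x hx (by
    filter_upwards [hmax] with y hy
    simp only [uscWrt_neg] at hy
    linarith)
  rw [slopeWrt_neg, slopeWrt_neg] at this
  rwa [uscWrt_neg, Hlow_neg, neg_nonpos]

theorem continuousOn_hamiltonian_neg (hH : ContinuousOn
    (fun q : Y × ℝ × ℝ => H q.1 q.2.1 q.2.2) (S ×ˢ (univ : Set ℝ) ×ˢ Ici (0 : ℝ))) :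
    ContinuousOn (fun q : Y × ℝ × ℝ => -H q.1 (-q.2.1) q.2.2)
      (S ×ˢ (univ : Set ℝ) ×ˢ Ici (0 : ℝ)) :=
  (hH.comp (f := fun q : Y × ℝ × ℝ => (q.1, -q.2.1, q.2.2)) (by fun_prop)
    fun _ hq => ⟨hq.1, mem_univ _, hq.2.2⟩).neg

end Neg

/-! ### Hausdorff convergence -/

section Hausdorff

variable {Y : Type*} [MetricSpace Y] {X : ℕ → Set Y} {Xi : Set Y}

theorem exists_dist_le_hausdorffDist {A B : Set Y} (hA : IsCompact A) (hB : IsCompact B)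
    (hBne : B.Nonempty) {x : Y} (hx : x ∈ A) : ∃ y ∈ B, dist x y ≤ hausdorffDist A B := by
  obtain ⟨y, hy, hxy⟩ := hB.exists_infDist_eq_dist hBne x
  exact ⟨y, hy, hxy ▸ infDist_le_hausdorffDist_of_mem hx
    (hausdorffEDist_ne_top_of_nonempty_of_bounded ⟨x, hx⟩ hBne hA.isBounded hB.isBounded)⟩

theorem exists_seq_tendsto_of_hausdorffDist (hXne : ∀ n, (X n).Nonempty)
    (hXc : ∀ n, IsCompact (X n)) (hXic : IsCompact Xi)
    (h1 : Tendsto (fun n => hausdorffDist (X n) Xi) atTop (𝓝 0)) {x : Y} (hx : x ∈ Xi) :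
    ∃ xn : ℕ → Y, (∀ n, xn n ∈ X n) ∧ Tendsto xn atTop (𝓝 x) := by
  choose xn hxn hdist using fun n => exists_dist_le_hausdorffDist hXic (hXc n) (hXne n) hx
  refine ⟨xn, hxn, tendsto_iff_dist_tendsto_zero.2
    (squeeze_zero (fun _ => dist_nonneg) (fun n => ?_) h1)⟩
  rw [dist_comm, hausdorffDist_comm]
  exact hdist n

theorem exists_subseq_tendsto_of_hausdorffDist (hXc : ∀ n, IsCompact (X n)) (hXic : IsCompact Xi)
    (hXine : Xi.Nonempty) (h1 : Tendsto (fun n => hausdorffDist (X n) Xi) atTop (𝓝 0))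
    {φ : ℕ → ℕ} (hφ : Tendsto φ atTop atTop) {x : ℕ → Y} (hx : ∀ k, x k ∈ X (φ k)) :
    ∃ p ∈ Xi, ∃ θ : ℕ → ℕ, StrictMono θ ∧ Tendsto (x ∘ θ) atTop (𝓝 p) := by
  choose y hy hdist using fun k => exists_dist_le_hausdorffDist (hXc (φ k)) hXic hXine (hx k)
  obtain ⟨p, hp, θ, hθ, hyp⟩ := hXic.tendsto_subseq hy
  have h0 : Tendsto (fun k => dist (y k) (x k)) atTop (𝓝 0) :=
    squeeze_zero (fun _ => dist_nonneg) (fun k => (dist_comm _ _).trans_le (hdist k)) (h1.comp hφ)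
  exact ⟨p, hp, θ, hθ, (tendsto_iff_of_dist (h0.comp hθ.tendsto_atTop)).1 hyp⟩

theorem tendsto_metric_approachFilter {d : ℕ → Y → Y → ℝ} {a b : Y} {L : ℝ} {an bn : ℕ → Y}
    (han : ∀ n, an n ∈ X n) (hbn : ∀ n, bn n ∈ X n) (ha : Tendsto an atTop (𝓝 a))
    (hb : Tendsto bn atTop (𝓝 b))
    (hd : ∀ an bn : ℕ → Y, (∀ n, an n ∈ X n) → (∀ n, bn n ∈ X n) →
      Tendsto an atTop (𝓝 a) → Tendsto bn atTop (𝓝 b) →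
      Tendsto (fun n => d n (an n) (bn n)) atTop (𝓝 L)) :
    Tendsto (fun q : ℕ × Y × Y => d q.1 q.2.1 q.2.2)
      (approachFilter (fun n => X n ×ˢ X n) (a, b)) (𝓝 L) :=
  tendsto_approachFilter_of_seq (S := fun n => X n ×ˢ X n) (z := (a, b))
    (f := fun n w => d n w.1 w.2) (z₀ := fun n => (an n, bn n)) (fun n => ⟨han n, hbn n⟩)
    (ha.prodMk_nhds hb) fun w hw hwl =>
    hd (fun n => (w n).1) (fun n => (w n).2) (fun n => (hw n).1) (fun n => (hw n).2)
      hwl.fst_nhds hwl.snd_nhds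

theorem tendsto_hamiltonian_approachFilter {H : ℕ → Y → ℝ → ℝ → ℝ} {x : Y} {r p L : ℝ}
    {xn : ℕ → Y} (hxn : ∀ n, xn n ∈ X n) (hx : Tendsto xn atTop (𝓝 x)) (hp : 0 ≤ p)
    (hH : ∀ xn : ℕ → Y, (∀ n, xn n ∈ X n) → Tendsto xn atTop (𝓝 x) →
      ∀ rn pn : ℕ → ℝ, (∀ n, 0 ≤ pn n) → Tendsto rn atTop (𝓝 r) → Tendsto pn atTop (𝓝 p) →
      Tendsto (fun n => H n (xn n) (rn n) (pn n)) atTop (𝓝 L)) :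
    Tendsto (fun q : ℕ × Y × ℝ × ℝ => H q.1 q.2.1 q.2.2.1 q.2.2.2)
      (approachFilter (fun n => X n ×ˢ (univ : Set ℝ) ×ˢ Ici (0 : ℝ)) (x, r, p)) (𝓝 L) :=
  tendsto_approachFilter_of_seq (S := fun n => X n ×ˢ (univ : Set ℝ) ×ˢ Ici (0 : ℝ))
    (z := (x, r, p)) (f := fun n w => H n w.1 w.2.1 w.2.2) (z₀ := fun n => (xn n, r, p))
    (fun n => ⟨hxn n, mem_univ _, hp⟩) (hx.prodMk_nhds tendsto_const_nhds) fun w hw hwl =>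
    hH (fun n => (w n).1) (fun n => (hw n).1) hwl.fst_nhds (fun n => (w n).2.1)
      (fun n => (w n).2.2) (fun n => (hw n).2.2) hwl.snd_nhds.fst_nhds hwl.snd_nhds.snd_nhds

/-- Convergence along `approachFilter X x` at every point of a compact set is uniform. -/
theorem uniform_of_tendsto_approachFilter {u : ℕ → Y → ℝ} {v : Y → ℝ} (hXic : IsCompact Xi)
    (hXi : ∀ x ∈ Xi, (approachFilter X x).NeBot)
    (hlim : ∀ x ∈ Xi, Tendsto (fun q : ℕ × Y => u q.1 q.2) (approachFilter X x) (𝓝 (v x)))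
    {ε : ℝ} (hε : 0 < ε) :
    ∃ N : ℕ, ∃ δ : ℝ, 0 < δ ∧
      ∀ n ≥ N, ∀ x ∈ X n, ∀ y ∈ Xi, dist x y < δ → |u n x - v y| < ε := by
  suffices ∃ N : ℕ, ∃ δ : ℝ, 0 < δ ∧
      ∀ n ≥ N, ∀ y ∈ Xi, ∀ x ∈ X n, dist x y < δ → |u n x - v y| < ε by
    obtain ⟨N, δ, hδ, hN⟩ := this
    exact ⟨N, δ, hδ, fun n hn x hx y hy => hN n hn y hy x hx⟩
  refine hXic.induction_on (p := fun s => ∃ N : ℕ, ∃ δ : ℝ, 0 < δ ∧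
      ∀ n ≥ N, ∀ y ∈ s, ∀ x ∈ X n, dist x y < δ → |u n x - v y| < ε)
    ⟨0, 1, one_pos, by simp⟩ ?_ ?_ ?_
  · rintro s t hst ⟨N, δ, hδ, h⟩
    exact ⟨N, δ, hδ, fun n hn y hy => h n hn y (hst hy)⟩
  · rintro s t ⟨N, δ, hδ, h⟩ ⟨N', δ', hδ', h'⟩
    refine ⟨max N N', min δ δ', lt_min hδ hδ', fun n hn y hy x hx hxy => ?_⟩
    rcases hy with hy | hy
    · exact h n (le_of_max_le_left hn) y hy x hx (hxy.trans_le (min_le_left _ _))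
    · exact h' n (le_of_max_le_right hn) y hy x hx (hxy.trans_le (min_le_right _ _))
  · intro y hy
    obtain ⟨N, δ, hδ, hN⟩ := eventually_approachFilter_iff.1
      ((hlim y hy).eventually (ball_mem_nhds (v y) (half_pos hε)))
    refine ⟨Xi ∩ ball y (δ / 2), inter_mem self_mem_nhdsWithin
      (mem_nhdsWithin_of_mem_nhds (ball_mem_nhds y (half_pos hδ))), N, δ / 2, half_pos hδ, ?_⟩
    rintro n hn z ⟨hz, hzy⟩ x hx hxz
    rw [mem_ball] at hzy
    have hclose : |v z - v y| ≤ ε / 2 := by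
      have := hXi z hz
      refine le_of_tendsto ((hlim z hz).sub_const (v y)).abs (eventually_approachFilter_iff.2
        ⟨N, δ / 2, half_pos hδ, fun m hm w hw hwz => (hN m hm w hw ?_).le⟩)
      linarith [dist_triangle w z y]
    have hx' : |u n x - v y| < ε / 2 := hN n hn x hx (by linarith [dist_triangle x z y])
    rw [abs_sub_comm] at hclose
    linarith [abs_sub_le (u n x) (v y) (v z)]

end Hausdorff

/-- convergence of metric viscosity solutions under the comparison
principle for the limit equation. -/
theorem stmt10 {Y : Type*} [MetricSpace Y] [LocallyCompactSpace Y]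
    (X : ℕ → Set Y) (Xi : Set Y)
    (d : ℕ → Y → Y → ℝ) (di : Y → Y → ℝ)
    (H : ℕ → Y → ℝ → ℝ → ℝ) (Hi : Y → ℝ → ℝ → ℝ)
    (u : ℕ → Y → ℝ) (ui : Y → ℝ)
    (hXne : ∀ n, (X n).Nonempty) (hXc : ∀ n, IsCompact (X n))
    (hXine : Xi.Nonempty) (hXic : IsCompact Xi)
    (hmet : ∀ n, IsMetricOn (X n) (d n)) (hgeo : ∀ n, IsGeodesicWrt (X n) (d n))
    (hmeti : IsMetricOn Xi di) (hgeoi : IsGeodesicWrt Xi di)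
    (hHc : ∀ n, ContinuousOn (fun q : Y × ℝ × ℝ => H n q.1 q.2.1 q.2.2)
      (X n ×ˢ (univ : Set ℝ) ×ˢ Ici (0:ℝ)))
    (hHic : ContinuousOn (fun q : Y × ℝ × ℝ => Hi q.1 q.2.1 q.2.2)
      (Xi ×ˢ (univ : Set ℝ) ×ˢ Ici (0:ℝ)))
    (h1 : Tendsto (fun n => hausdorffDist (X n) Xi) atTop (𝓝 0))
    (h2 : ∀ a ∈ Xi, ∀ b ∈ Xi, ∀ an bn : ℕ → Y, (∀ n, an n ∈ X n) → (∀ n, bn n ∈ X n) →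
      Tendsto an atTop (𝓝 a) → Tendsto bn atTop (𝓝 b) →
      Tendsto (fun n => d n (an n) (bn n)) atTop (𝓝 (di a b)))
    (h3 : ∀ x ∈ Xi, ∀ xn : ℕ → Y, (∀ n, xn n ∈ X n) → Tendsto xn atTop (𝓝 x) →
      ∀ r p : ℝ, 0 ≤ p → ∀ rn pn : ℕ → ℝ, (∀ n, 0 ≤ pn n) →
      Tendsto rn atTop (𝓝 r) → Tendsto pn atTop (𝓝 p) →
      Tendsto (fun n => H n (xn n) (rn n) (pn n)) atTop (𝓝 (Hi x r p)))
    (hcomp : ∀ v w : Y → ℝ, IsMVSubsolutionWrt Xi di Hi v → (∃ C : ℝ, ∀ x ∈ Xi, v x ≤ C) →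
      IsMVSupersolutionWrt Xi di Hi w → (∃ C : ℝ, ∀ x ∈ Xi, C ≤ w x) →
      ∀ x ∈ Xi, v x ≤ w x)
    (hsub : ∀ n, IsMVSubsolutionWrt (X n) (d n) (H n) (u n))
    (hsup : ∀ n, IsMVSupersolutionWrt (X n) (d n) (H n) (u n))
    (hbdd : ∃ C : ℝ, ∀ n, ∀ x ∈ X n, |u n x| ≤ C)
    (huisub : IsMVSubsolutionWrt Xi di Hi ui)
    (huisup : IsMVSupersolutionWrt Xi di Hi ui)
    (huib : ∃ C : ℝ, ∀ x ∈ Xi, |ui x| ≤ C) :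
    (∀ x ∈ Xi,
      sSup {L : ℝ | ∃ xn : ℕ → Y, (∀ n, xn n ∈ X n) ∧ Tendsto xn atTop (𝓝 x) ∧
        Filter.limsup (fun n => u n (xn n)) atTop = L} = ui x ∧
      sInf {L : ℝ | ∃ xn : ℕ → Y, (∀ n, xn n ∈ X n) ∧ Tendsto xn atTop (𝓝 x) ∧
        Filter.liminf (fun n => u n (xn n)) atTop = L} = ui x) ∧
    ∀ ε : ℝ, 0 < ε → ∃ N : ℕ, ∃ δ : ℝ, 0 < δ ∧
      ∀ n ≥ N, ∀ x ∈ X n, ∀ y ∈ Xi, dist x y < δ → |u n x - ui y| < ε := by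
  obtain ⟨C, hC⟩ := hbdd
  have happ := fun x (hx : x ∈ Xi) => exists_seq_tendsto_of_hausdorffDist hXne hXc hXic h1 hx
  have hXi : ∀ x ∈ Xi, (approachFilter X x).NeBot := fun x hx => by
    obtain ⟨xn, hxn, hlim⟩ := happ x hx
    exact (tendsto_approachFilter tendsto_id hlim (Eventually.of_forall hxn)).neBot
  have hd : ∀ a ∈ Xi, ∀ b ∈ Xi, Tendsto (fun q : ℕ × Y × Y => d q.1 q.2.1 q.2.2)
      (approachFilter (fun n => X n ×ˢ X n) (a, b)) (𝓝 (di a b)) := by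
    intro a ha b hb
    obtain ⟨an, han, hanl⟩ := happ a ha
    obtain ⟨bn, hbn, hbnl⟩ := happ b hb
    exact tendsto_metric_approachFilter han hbn hanl hbnl (h2 a ha b hb)
  have hH : ∀ x ∈ Xi, ∀ r p : ℝ, 0 ≤ p →
      Tendsto (fun q : ℕ × Y × ℝ × ℝ => H q.1 q.2.1 q.2.2.1 q.2.2.2)
        (approachFilter (fun n => X n ×ˢ (univ : Set ℝ) ×ˢ Ici (0 : ℝ)) (x, r, p))
        (𝓝 (Hi x r p)) := by
    intro x hx r p hp
    obtain ⟨xn, hxn, hxnl⟩ := happ x hx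
    exact tendsto_hamiltonian_approachFilter hxn hxnl hp fun yn hyn hy =>
      h3 x hx yn hyn hy r p hp
  have hHneg : ∀ x ∈ Xi, ∀ r p : ℝ, 0 ≤ p →
      Tendsto (fun q : ℕ × Y × ℝ × ℝ => -H q.1 q.2.1 (-q.2.2.1) q.2.2.2)
        (approachFilter (fun n => X n ×ˢ (univ : Set ℝ) ×ˢ Ici (0 : ℝ)) (x, r, p))
        (𝓝 (-Hi x (-r) p)) := by
    intro x hx r p hp
    obtain ⟨xn, hxn, hxnl⟩ := happ x hx
    exact tendsto_hamiltonian_approachFilter (H := fun n x r p => -H n x (-r) p) hxn hxnl hp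
      fun yn hyn hy rn pn hpn hr hpl =>
        (h3 x hx yn hyn hy (-r) p hp (fun n => -rn n) pn hpn hr.neg hpl).neg
  have hcpt := fun (φ : ℕ → ℕ) (hφ : Tendsto φ atTop atTop) (x : ℕ → Y) (hx : ∀ k, x k ∈ X (φ k)) =>
    exists_subseq_tendsto_of_hausdorffDist hXc hXic hXine h1 hφ hx
  have hCneg : ∀ n, ∀ x ∈ X n, |(fun n y => -u n y) n x| ≤ C := fun n x hx => by
    simpa only [abs_neg] using hC n x hx
  have habs := fun x hx => abs_upperSemilimit_le hC (hXi x hx)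
  have habsneg := fun x hx => abs_upperSemilimit_le hCneg (hXi x hx)
  have hV : IsMVSubsolutionWrt Xi di Hi (upperSemilimit X u) :=
    (isConeSubsolution_upperSemilimit hXc hmet hgeo hmeti hHc happ hcpt hd hH hC hsub
      hXi).isMVSubsolutionWrt hXic hgeoi hmeti hHic (upperSemicontinuousOn_upperSemilimit hC hXi)
      habs
  have hVneg : IsMVSubsolutionWrt Xi di (fun x r p => -Hi x (-r) p)
      (upperSemilimit X fun n y => -u n y) :=
    (isConeSubsolution_upperSemilimit hXc hmet hgeo hmeti
      (fun n => continuousOn_hamiltonian_neg (hHc n)) happ hcpt hd hHneg hCneg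
      (fun n => (hsup n).neg) hXi).isMVSubsolutionWrt hXic hgeoi hmeti
      (continuousOn_hamiltonian_neg hHic) (upperSemicontinuousOn_upperSemilimit hCneg hXi) habsneg
  have hVsup : IsMVSupersolutionWrt Xi di Hi
      (fun x => -upperSemilimit X (fun n y => -u n y) x) :=
    IsMVSubsolutionWrt.of_neg (by simpa only [neg_neg] using hVneg)
  obtain ⟨C', hC'⟩ := huib
  have hle := hcomp _ _ hV ⟨C, fun x hx => (abs_le.1 (habs x hx)).2⟩ huisup
    ⟨-C', fun x hx => (abs_le.1 (hC' x hx)).1⟩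
  have hge := hcomp _ _ huisub ⟨C', fun x hx => (abs_le.1 (hC' x hx)).2⟩ hVsup
    ⟨-C, fun x hx => neg_le_neg (abs_le.1 (habsneg x hx)).2⟩
  have hlim : ∀ x ∈ Xi,
      Tendsto (fun q : ℕ × Y => u q.1 q.2) (approachFilter X x) (𝓝 (ui x)) := by
    refine fun x hx => tendsto_order.2 ⟨fun c hc => ?_, fun c hc =>
      eventually_lt_of_upperSemilimit_lt hC ((hle x hx).trans_lt hc)⟩
    exact (eventually_lt_of_upperSemilimit_lt hCneg (x := x) (c := -c)
      (by linarith [hge x hx])).mono fun q hq => neg_lt_neg_iff.1 hq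
  refine ⟨fun x hx => ?_, fun ε hε => uniform_of_tendsto_approachFilter hXic hXi hlim hε⟩
  have hseq : ∀ xn : ℕ → Y, (∀ n, xn n ∈ X n) → Tendsto xn atTop (𝓝 x) →
      Tendsto (fun n => u n (xn n)) atTop (𝓝 (ui x)) := fun xn hxn hxnl =>
    (hlim x hx).comp (tendsto_approachFilter tendsto_id hxnl (Eventually.of_forall hxn))
  obtain ⟨xn, hxn, hxnl⟩ := happ x hx
  constructor
  · refine (congrArg sSup (Set.ext fun L => ⟨?_, ?_⟩)).trans (csSup_singleton (ui x))
    · rintro ⟨yn, hyn, hynl, rfl⟩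
      exact (hseq yn hyn hynl).limsup_eq
    · rintro rfl
      exact ⟨xn, hxn, hxnl, (hseq xn hxn hxnl).limsup_eq⟩
  · refine (congrArg sInf (Set.ext fun L => ⟨?_, ?_⟩)).trans (csInf_singleton (ui x))
    · rintro ⟨yn, hyn, hynl, rfl⟩
      exact (hseq yn hyn hynl).liminf_eq
    · rintro rfl
      exact ⟨xn, hxn, hxnl, (hseq xn hxn hxnl).liminf_eq⟩
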